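/- Capacity with no backward cross-link (Theorem 3): For the deterministic two-hop interference channel with parameters (n, m, f, n̄, m̄) with m̄ = 0, the sum capacity equals: if 3m ≤ 2n, C_sum = min{f + max(n−m, m) + (n̄ − f)⁺, 2·max(n−m, m) + 2n̄, 2n − m, 2f}; if 2n ≤ 3m and m ≤ 2n, C_sum = min{max(2n−m, m), 2f}; and if m ≥ 2n, C_sum = min{n + f + (n̄ − f)⁺, 2n + 2n̄, m, 2f}. -/

import Mathlib

open scoped Classical

namespace TwoHopIC

/-- The `q × q` lower-shift matrix `S^k` over `F₂`, with `(S^k)_{i,j} = 1` iff `i = j + k`. -/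
def shiftMat (q k : ℕ) : Matrix (Fin q) (Fin q) (ZMod 2) :=
  Matrix.of fun i j => if (i : ℕ) = (j : ℕ) + k then 1 else 0

/-- Forward (first-hop) signal alphabet: vectors in `F₂^q` with `q = max m n`. -/
abbrev FSig (n m : ℕ) := Fin (max m n) → ZMod 2

/-- Backward/second-hop signal alphabet: vectors in `F₂^q̄` with `q̄ = max(m̄, n̄, f)`. -/
abbrev BSig (f nb mb : ℕ) := Fin (max mb (max nb f)) → ZMod 2

/-- A blocklength-`N` code with message sets of sizes `M1`, `M2`:
causal encoders at the sources (using the messages and the overheard signals),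
causal encoders at the relays (using their received signals), and decoders at the
destinations (using the `N` received signals). -/
structure Code (n m f nb mb N M1 M2 : ℕ) where
  encS1 : (t : ℕ) → Fin M1 → (Fin t → BSig f nb mb) → FSig n m
  encS2 : (t : ℕ) → Fin M2 → (Fin t → BSig f nb mb) → FSig n m
  encR1 : (t : ℕ) → (Fin t → FSig n m) → BSig f nb mb
  encR2 : (t : ℕ) → (Fin t → FSig n m) → BSig f nb mb
  dec1 : (Fin N → BSig f nb mb) → Fin M1
  dec2 : (Fin N → BSig f nb mb) → Fin M2

variable {n m f nb mb N M1 M2 : ℕ}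

/-- Given a history `h` of source signals `(X_{S1}[·], X_{S2}[·])`, the signal received by
relay 1 at time `s`: `Y_{R1}[s] = S^{q-n} X_{S1}[s] ⊕ S^{q-m} X_{S2}[s]`. -/
def relayRx1 (n m : ℕ) {t : ℕ} (h : Fin t → FSig n m × FSig n m) (s : Fin t) : FSig n m :=
  (shiftMat (max m n) (max m n - n)).mulVec (h s).1 +
  (shiftMat (max m n) (max m n - m)).mulVec (h s).2

/-- `Y_{R2}[s] = S^{q-m} X_{S1}[s] ⊕ S^{q-n} X_{S2}[s]`. -/
def relayRx2 (n m : ℕ) {t : ℕ} (h : Fin t → FSig n m × FSig n m) (s : Fin t) : FSig n m :=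
  (shiftMat (max m n) (max m n - m)).mulVec (h s).1 +
  (shiftMat (max m n) (max m n - n)).mulVec (h s).2

/-- Relay 1 transmitted signal `X_{R1}[s]`, a causal function of `Y_{R1}[1..s-1]`. -/
def relayTx1 (C : Code n m f nb mb N M1 M2) {t : ℕ}
    (h : Fin t → FSig n m × FSig n m) (s : Fin t) : BSig f nb mb :=
  C.encR1 s.val (fun u => relayRx1 n m h ⟨u.val, lt_trans u.isLt s.isLt⟩)

/-- Relay 2 transmitted signal `X_{R2}[s]`, a causal function of `Y_{R2}[1..s-1]`. -/
def relayTx2 (C : Code n m f nb mb N M1 M2) {t : ℕ}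
    (h : Fin t → FSig n m × FSig n m) (s : Fin t) : BSig f nb mb :=
  C.encR2 s.val (fun u => relayRx2 n m h ⟨u.val, lt_trans u.isLt s.isLt⟩)

/-- Source 1 overheard signal `Y_{S1}[s] = S^{q̄-n̄} X_{R1}[s] ⊕ S^{q̄-m̄} X_{R2}[s]`. -/
def srcRx1 (C : Code n m f nb mb N M1 M2) {t : ℕ}
    (h : Fin t → FSig n m × FSig n m) (s : Fin t) : BSig f nb mb :=
  (shiftMat (max mb (max nb f)) (max mb (max nb f) - nb)).mulVec (relayTx1 C h s) +
  (shiftMat (max mb (max nb f)) (max mb (max nb f) - mb)).mulVec (relayTx2 C h s)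

/-- Source 2 overheard signal `Y_{S2}[s] = S^{q̄-n̄} X_{R2}[s] ⊕ S^{q̄-m̄} X_{R1}[s]`. -/
def srcRx2 (C : Code n m f nb mb N M1 M2) {t : ℕ}
    (h : Fin t → FSig n m × FSig n m) (s : Fin t) : BSig f nb mb :=
  (shiftMat (max mb (max nb f)) (max mb (max nb f) - nb)).mulVec (relayTx2 C h s) +
  (shiftMat (max mb (max nb f)) (max mb (max nb f) - mb)).mulVec (relayTx1 C h s)

/-- The history `(X_{S1}[1..t], X_{S2}[1..t])` of source signals determined by the
messages `(w1, w2)`: at each time the sources apply their causal encoders to their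
message and the overheard signals so far. -/
def srcHist (C : Code n m f nb mb N M1 M2) (w1 : Fin M1) (w2 : Fin M2) :
    (t : ℕ) → Fin t → FSig n m × FSig n m
  | 0 => fun i => i.elim0
  | t + 1 =>
    Fin.snoc (srcHist C w1 w2 t)
      (C.encS1 t w1 (srcRx1 C (srcHist C w1 w2 t)),
       C.encS2 t w2 (srcRx2 C (srcHist C w1 w2 t)))

/-- `(X_{S1}[t], X_{S2}[t])`. -/
def srcXat (C : Code n m f nb mb N M1 M2) (w1 : Fin M1) (w2 : Fin M2) (t : ℕ) :
    FSig n m × FSig n m :=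
  srcHist C w1 w2 (t + 1) (Fin.last t)

/-- `Y_{R1}[t]`. -/
def relayRxAt1 (C : Code n m f nb mb N M1 M2) (w1 : Fin M1) (w2 : Fin M2) (t : ℕ) :
    FSig n m :=
  relayRx1 n m (srcHist C w1 w2 (t + 1)) (Fin.last t)

/-- `Y_{R2}[t]`. -/
def relayRxAt2 (C : Code n m f nb mb N M1 M2) (w1 : Fin M1) (w2 : Fin M2) (t : ℕ) :
    FSig n m :=
  relayRx2 n m (srcHist C w1 w2 (t + 1)) (Fin.last t)

/-- `X_{R1}[t]`. -/
def relayTxAt1 (C : Code n m f nb mb N M1 M2) (w1 : Fin M1) (w2 : Fin M2) (t : ℕ) :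
    BSig f nb mb :=
  relayTx1 C (srcHist C w1 w2 (t + 1)) (Fin.last t)

/-- `X_{R2}[t]`. -/
def relayTxAt2 (C : Code n m f nb mb N M1 M2) (w1 : Fin M1) (w2 : Fin M2) (t : ℕ) :
    BSig f nb mb :=
  relayTx2 C (srcHist C w1 w2 (t + 1)) (Fin.last t)

/-- `Y_{D1}[t] = S^{q̄-f} X_{R1}[t]`. -/
def destRx1 (C : Code n m f nb mb N M1 M2) (w1 : Fin M1) (w2 : Fin M2) (t : ℕ) :
    BSig f nb mb :=
  (shiftMat (max mb (max nb f)) (max mb (max nb f) - f)).mulVec (relayTxAt1 C w1 w2 t)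

/-- `Y_{D2}[t] = S^{q̄-f} X_{R2}[t]`. -/
def destRx2 (C : Code n m f nb mb N M1 M2) (w1 : Fin M1) (w2 : Fin M2) (t : ℕ) :
    BSig f nb mb :=
  (shiftMat (max mb (max nb f)) (max mb (max nb f) - f)).mulVec (relayTxAt2 C w1 w2 t)

/-- Probability of decoding error under independent uniform messages: since the channel is
deterministic, this is the fraction of message pairs `(w1, w2)` on which some decoder errs. -/
noncomputable def errProb (C : Code n m f nb mb N M1 M2) : ℝ :=
  ((Finset.univ.filter fun w : Fin M1 × Fin M2 =>
      C.dec1 (fun t => destRx1 C w.1 w.2 t.val) ≠ w.1 ∨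
      C.dec2 (fun t => destRx2 C w.1 w.2 t.val) ≠ w.2).card : ℝ) / ((M1 : ℝ) * (M2 : ℝ))

/-- A nonnegative rate pair `(R1, R2)` is achievable if for every `ε > 0` there is a
blocklength `N ≥ 1` and a code with message sets of sizes `⌈2^(N R1)⌉`, `⌈2^(N R2)⌉`
whose probability of error is at most `ε`. -/
def Achievable (n m f nb mb : ℕ) (R1 R2 : ℝ) : Prop :=
  0 ≤ R1 ∧ 0 ≤ R2 ∧
    ∀ ε : ℝ, 0 < ε →
      ∃ N : ℕ, 0 < N ∧
        ∃ C : Code n m f nb mb N ⌈(2 : ℝ) ^ ((N : ℝ) * R1)⌉₊ ⌈(2 : ℝ) ^ ((N : ℝ) * R2)⌉₊,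
          errProb C ≤ ε

/-- The sum capacity `C_sum = sup { R1 + R2 : (R1, R2) achievable }`. -/
noncomputable def sumCapacity (n m f nb mb : ℕ) : ℝ :=
  sSup {r : ℝ | ∃ R1 R2 : ℝ, Achievable n m f nb mb R1 R2 ∧ r = R1 + R2}

end TwoHopIC

namespace TwoHopIC

/-- Extension of a finite vector by zero to all of `ℕ`. -/
def extend {q : ℕ} (x : Fin q → ZMod 2) (i : ℕ) : ZMod 2 :=
  if h : i < q then x ⟨i, h⟩ else 0

theorem extend_of_lt {q : ℕ} (x : Fin q → ZMod 2) {i : ℕ} (h : i < q) :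
    extend x i = x ⟨i, h⟩ := dif_pos h

theorem extend_mk {q : ℕ} (g : ℕ → ZMod 2) (i : ℕ) :
    extend (fun j : Fin q => g j) i = if i < q then g i else 0 := by
  unfold extend; split_ifs <;> rfl

theorem extend_injective {q : ℕ} {x y : Fin q → ZMod 2}
    (h : ∀ i < q, extend x i = extend y i) : x = y := by
  funext i
  simpa [extend] using h i i.isLt

theorem shiftMat_mulVec (q k : ℕ) (x : Fin q → ZMod 2) (i : Fin q) :
    (shiftMat q k).mulVec x i = if k ≤ i then extend x (i - k) else 0 := by
  simp only [Matrix.mulVec, dotProduct, shiftMat, Matrix.of_apply, ite_mul, one_mul, zero_mul]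
  split_ifs with h
  · have hlt : (i : ℕ) - k < q := by omega
    rw [extend_of_lt x hlt, Finset.sum_eq_single (⟨i - k, hlt⟩ : Fin q)]
    · rw [if_pos (by simp only; omega)]
    · intro b _ hb
      rw [if_neg]
      intro hc
      exact hb (Fin.ext (by simp only; omega))
    · simp
  · exact Finset.sum_eq_zero fun j _ => if_neg (by omega)

/-- The first hop: the signal at a relay whose own source sends `x` and whose interfering
source sends `y`. -/
def fwd (n m : ℕ) (x y : FSig n m) : FSig n m :=
  (shiftMat (max m n) (max m n - n)).mulVec x + (shiftMat (max m n) (max m n - m)).mulVec y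

/-- The part of a relay signal received over a link of strength `k`. -/
def bwd (f nb k : ℕ) (x : BSig f nb 0) : BSig f nb 0 :=
  (shiftMat (max 0 (max nb f)) (max 0 (max nb f) - k)).mulVec x

theorem extend_fwd (n m : ℕ) (x y : FSig n m) {i : ℕ} (hi : i < max m n) :
    extend (fwd n m x y) i =
      (if max m n - n ≤ i then extend x (i - (max m n - n)) else 0) +
      (if max m n - m ≤ i then extend y (i - (max m n - m)) else 0) := by
  rw [extend_of_lt _ hi]
  simp [fwd, shiftMat_mulVec]

theorem bwd_zero (f nb : ℕ) (x : BSig f nb 0) : bwd f nb 0 x = 0 := by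
  funext i
  simp only [bwd, shiftMat_mulVec, Pi.zero_apply]
  rw [if_neg]
  omega

theorem bwd_eq_iff (f nb k : ℕ) (hk : k ≤ max nb f) (x y : BSig f nb 0) :
    bwd f nb k x = bwd f nb k y ↔ ∀ i < k, extend x i = extend y i := by
  constructor
  · intro h i hi
    have := congrFun h ⟨i + (max 0 (max nb f) - k), by omega⟩
    simpa [bwd, shiftMat_mulVec] using this
  · intro h
    funext i
    simp only [bwd, shiftMat_mulVec]
    split_ifs
    · exact h _ (by omega)
    · rfl

variable {n m f nb N M1 M2 : ℕ}

theorem relayRx1_eq {t : ℕ} (h : Fin t → FSig n m × FSig n m) (s : Fin t) :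
    relayRx1 n m h s = fwd n m (h s).1 (h s).2 := rfl

theorem relayRx2_eq {t : ℕ} (h : Fin t → FSig n m × FSig n m) (s : Fin t) :
    relayRx2 n m h s = fwd n m (h s).2 (h s).1 := add_comm _ _

theorem srcRx1_eq (C : Code n m f nb 0 N M1 M2) {t : ℕ}
    (h : Fin t → FSig n m × FSig n m) (s : Fin t) :
    srcRx1 C h s = bwd f nb nb (relayTx1 C h s) := by
  change bwd f nb nb (relayTx1 C h s) + bwd f nb 0 (relayTx2 C h s) = _
  rw [bwd_zero, add_zero]

theorem srcRx2_eq (C : Code n m f nb 0 N M1 M2) {t : ℕ}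
    (h : Fin t → FSig n m × FSig n m) (s : Fin t) :
    srcRx2 C h s = bwd f nb nb (relayTx2 C h s) := by
  change bwd f nb nb (relayTx2 C h s) + bwd f nb 0 (relayTx1 C h s) = _
  rw [bwd_zero, add_zero]

/-- Signal trajectories, as functions of the two messages, that respect the information
available at each terminal and allow error-free decoding after `N` channel uses. -/
structure ZeroErrorScheme (n m f nb N : ℕ) (Ω₁ Ω₂ : Type) where
  x₁ : Ω₁ → Ω₂ → ℕ → FSig n m
  x₂ : Ω₁ → Ω₂ → ℕ → FSig n m
  r₁ : Ω₁ → Ω₂ → ℕ → BSig f nb 0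
  r₂ : Ω₁ → Ω₂ → ℕ → BSig f nb 0
  source₁ : ∀ a b b' t, (∀ s < t, bwd f nb nb (r₁ a b s) = bwd f nb nb (r₁ a b' s)) →
    x₁ a b t = x₁ a b' t
  source₂ : ∀ a a' b t, (∀ s < t, bwd f nb nb (r₂ a b s) = bwd f nb nb (r₂ a' b s)) →
    x₂ a b t = x₂ a' b t
  relay₁ : ∀ a b a' b' t, (∀ s < t, fwd n m (x₁ a b s) (x₂ a b s) =
    fwd n m (x₁ a' b' s) (x₂ a' b' s)) → r₁ a b t = r₁ a' b' t
  relay₂ : ∀ a b a' b' t, (∀ s < t, fwd n m (x₂ a b s) (x₁ a b s) =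
    fwd n m (x₂ a' b' s) (x₁ a' b' s)) → r₂ a b t = r₂ a' b' t
  dest₁ : ∀ a b a' b', (∀ t < N, bwd f nb f (r₁ a b t) = bwd f nb f (r₁ a' b' t)) → a = a'
  dest₂ : ∀ a b a' b', (∀ t < N, bwd f nb f (r₂ a b t) = bwd f nb f (r₂ a' b' t)) → b = b'

namespace ZeroErrorScheme

/-- Restriction of a scheme to smaller message sets. -/
def comap {Ω₁ Ω₂ Ω₁' Ω₂' : Type} (S : ZeroErrorScheme n m f nb N Ω₁ Ω₂)
    (ι₁ : Ω₁' ↪ Ω₁) (ι₂ : Ω₂' ↪ Ω₂) : ZeroErrorScheme n m f nb N Ω₁' Ω₂' where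
  x₁ a b := S.x₁ (ι₁ a) (ι₂ b)
  x₂ a b := S.x₂ (ι₁ a) (ι₂ b)
  r₁ a b := S.r₁ (ι₁ a) (ι₂ b)
  r₂ a b := S.r₂ (ι₁ a) (ι₂ b)
  source₁ _ _ _ := S.source₁ _ _ _
  source₂ _ _ _ := S.source₂ _ _ _
  relay₁ _ _ _ _ := S.relay₁ _ _ _ _
  relay₂ _ _ _ _ := S.relay₂ _ _ _ _
  dest₁ _ _ _ _ h := ι₁.injective (S.dest₁ _ _ _ _ h)
  dest₂ _ _ _ _ h := ι₂.injective (S.dest₂ _ _ _ _ h)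

/-- A function that factors through `g`, evaluated on a value of `g`. -/
theorem choose_factor {α β γ : Type*} [Inhabited γ] (g : α → β) (h : α → γ)
    (hgh : ∀ a a', g a = g a' → h a = h a') :
    ∃ k : β → γ, ∀ a, k (g a) = h a :=
  ⟨Function.extend g h default, fun a =>
    (show Function.FactorsThrough h g from fun a a' => hgh a a').extend_apply default a⟩

theorem exists_code [NeZero M1] [NeZero M2]
    (S : ZeroErrorScheme n m f nb N (Fin M1) (Fin M2)) :
    ∃ C : Code n m f nb 0 N M1 M2, errProb C = 0 := by
  choose e₁ he₁ using fun (t : ℕ) (a : Fin M1) => choose_factor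
    (fun b (s : Fin t) => bwd f nb nb (S.r₁ a b s)) (fun b => S.x₁ a b t)
    (fun b b' h => S.source₁ a b b' t fun s hs => congrFun h ⟨s, hs⟩)
  choose e₂ he₂ using fun (t : ℕ) (b : Fin M2) => choose_factor
    (fun a (s : Fin t) => bwd f nb nb (S.r₂ a b s)) (fun a => S.x₂ a b t)
    (fun a a' h => S.source₂ a a' b t fun s hs => congrFun h ⟨s, hs⟩)
  choose g₁ hg₁ using fun t : ℕ => choose_factor
    (fun (w : Fin M1 × Fin M2) (s : Fin t) => fwd n m (S.x₁ w.1 w.2 s) (S.x₂ w.1 w.2 s))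
    (fun w => S.r₁ w.1 w.2 t)
    (fun w w' h => S.relay₁ _ _ _ _ t fun s hs => congrFun h ⟨s, hs⟩)
  choose g₂ hg₂ using fun t : ℕ => choose_factor
    (fun (w : Fin M1 × Fin M2) (s : Fin t) => fwd n m (S.x₂ w.1 w.2 s) (S.x₁ w.1 w.2 s))
    (fun w => S.r₂ w.1 w.2 t)
    (fun w w' h => S.relay₂ _ _ _ _ t fun s hs => congrFun h ⟨s, hs⟩)
  obtain ⟨d₁, hd₁⟩ := choose_factor
    (fun (w : Fin M1 × Fin M2) (t : Fin N) => bwd f nb f (S.r₁ w.1 w.2 t)) (fun w => w.1)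
    (fun w w' h => S.dest₁ _ _ _ _ fun t ht => congrFun h ⟨t, ht⟩)
  obtain ⟨d₂, hd₂⟩ := choose_factor
    (fun (w : Fin M1 × Fin M2) (t : Fin N) => bwd f nb f (S.r₂ w.1 w.2 t)) (fun w => w.2)
    (fun w w' h => S.dest₂ _ _ _ _ fun t ht => congrFun h ⟨t, ht⟩)
  let C : Code n m f nb 0 N M1 M2 := ⟨e₁, e₂, g₁, g₂, d₁, d₂⟩
  have tx₁ : ∀ a b t (s : Fin t),
      relayTx1 C (fun s : Fin t => (S.x₁ a b s, S.x₂ a b s)) s = S.r₁ a b s :=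
    fun a b t s => hg₁ s (a, b)
  have tx₂ : ∀ a b t (s : Fin t),
      relayTx2 C (fun s : Fin t => (S.x₁ a b s, S.x₂ a b s)) s = S.r₂ a b s := by
    intro a b t s
    rw [← hg₂ s (a, b)]
    simp only [relayTx2, relayRx2_eq]
    rfl
  have hist : ∀ a b t, srcHist C a b t = fun s : Fin t => (S.x₁ a b s, S.x₂ a b s) := by
    intro a b t
    induction t with
    | zero => funext i; exact i.elim0
    | succ t ih =>
      funext s
      rw [srcHist, ih]
      refine Fin.lastCases ?_ (fun i => ?_) s
      · rw [Fin.snoc_last]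
        refine Prod.ext ?_ ?_
        · simp only [Fin.val_last]
          rw [← he₁ t a b]
          exact congrArg (e₁ t a) (funext fun s => by rw [srcRx1_eq, tx₁])
        · simp only [Fin.val_last]
          rw [← he₂ t b a]
          exact congrArg (e₂ t b) (funext fun s => by rw [srcRx2_eq, tx₂])
      · rw [Fin.snoc_castSucc]
        rfl
  refine ⟨C, ?_⟩
  have h₁ : ∀ a b t, destRx1 C a b t = bwd f nb f (S.r₁ a b t) := by
    intro a b t
    simp only [destRx1, relayTxAt1, hist, tx₁, Fin.val_last]
    rfl
  have h₂ : ∀ a b t, destRx2 C a b t = bwd f nb f (S.r₂ a b t) := by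
    intro a b t
    simp only [destRx2, relayTxAt2, hist, tx₂, Fin.val_last]
    rfl
  rw [errProb, Finset.filter_false_of_mem]
  · simp
  · intro w _
    simp only [h₁, h₂, not_or, not_not]
    exact ⟨hd₁ w, hd₂ w⟩

end ZeroErrorScheme

/-- Zero-error schemes whose normalized message sizes tend to `k₁ / T` and `k₂ / T`
bound the sum capacity from below. -/
theorem le_sumCapacity_of_schemes (T c k₁ k₂ : ℕ) (hT : 0 < T)
    (hb : BddAbove {r : ℝ | ∃ R1 R2 : ℝ, Achievable n m f nb 0 R1 R2 ∧ r = R1 + R2})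
    (h : ∀ K : ℕ, ∃ (Ω₁ Ω₂ : Type) (_ : Fintype Ω₁) (_ : Fintype Ω₂),
      2 ^ (K * k₁) ≤ Fintype.card Ω₁ ∧ 2 ^ (K * k₂) ≤ Fintype.card Ω₂ ∧
      Nonempty (ZeroErrorScheme n m f nb (T * K + c) Ω₁ Ω₂)) :
    ((k₁ : ℝ) + k₂) / T ≤ sumCapacity n m f nb 0 := by
  have hT' : (0 : ℝ) < T := by exact_mod_cast hT
  have key : ∀ θ : ℝ, 0 < θ → θ < 1 → θ * (((k₁ : ℝ) + k₂) / T) ≤ sumCapacity n m f nb 0 := by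
    intro θ h0 h1
    obtain ⟨K, hK⟩ := exists_nat_gt (θ * c / (T * (1 - θ)) + 1)
    have hpos : 0 < (T : ℝ) * (1 - θ) := mul_pos hT' (by linarith)
    have hK1 : (1 : ℝ) < K := by
      have : 0 ≤ θ * c / (T * (1 - θ)) := by positivity
      linarith
    have hK0 : 0 < K := by
      have : (0 : ℝ) < K := by linarith
      exact_mod_cast this
    have hN : θ * ((T * K + c : ℕ) : ℝ) ≤ T * K := by
      have : θ * c / (T * (1 - θ)) < K := by linarith
      rw [div_lt_iff₀ hpos] at this
      push_cast
      nlinarith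
    have size : ∀ k : ℕ, ⌈(2 : ℝ) ^ (((T * K + c : ℕ) : ℝ) * (θ * (k / T)))⌉₊ ≤ 2 ^ (K * k) := by
      intro k
      rw [Nat.ceil_le]
      push_cast
      rw [← Real.rpow_natCast]
      apply Real.rpow_le_rpow_of_exponent_le (by norm_num)
      have : (T : ℝ) * K * (k / T) = K * k := by field_simp
      push_cast at hN ⊢
      rw [← this]
      calc ((T : ℝ) * K + c) * (θ * (k / T)) = θ * (T * K + c) * (k / T) := by ring
        _ ≤ _ := by gcongr
    apply le_csSup hb
    refine ⟨θ * (k₁ / T), θ * (k₂ / T), ⟨by positivity, by positivity, fun ε hε => ?_⟩, by ring⟩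
    refine ⟨T * K + c, by positivity, ?_⟩
    obtain ⟨Ω₁, Ω₂, _, _, hc₁, hc₂, ⟨S⟩⟩ := h K
    have ne : ∀ r : ℝ, NeZero ⌈(2 : ℝ) ^ r⌉₊ := fun r =>
      ⟨(Nat.ceil_pos.2 (Real.rpow_pos_of_pos (by norm_num) _)).ne'⟩
    have := ne (((T * K + c : ℕ) : ℝ) * (θ * (k₁ / T)))
    have := ne (((T * K + c : ℕ) : ℝ) * (θ * (k₂ / T)))
    obtain ⟨ι₁⟩ := Function.Embedding.nonempty_of_card_le
      (α := Fin ⌈(2 : ℝ) ^ (((T * K + c : ℕ) : ℝ) * (θ * (k₁ / T)))⌉₊) (β := Ω₁)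
      (by rw [Fintype.card_fin]; exact (size k₁).trans hc₁)
    obtain ⟨ι₂⟩ := Function.Embedding.nonempty_of_card_le
      (α := Fin ⌈(2 : ℝ) ^ (((T * K + c : ℕ) : ℝ) * (θ * (k₂ / T)))⌉₊) (β := Ω₂)
      (by rw [Fintype.card_fin]; exact (size k₂).trans hc₂)
    obtain ⟨C, hC⟩ := (S.comap ι₁ ι₂).exists_code
    exact ⟨C, hC.trans_le hε.le⟩
  have hlim : Filter.Tendsto (fun θ : ℝ => θ * (((k₁ : ℝ) + k₂) / T))
      (nhdsWithin 1 (Set.Iio 1)) (nhds (1 * (((k₁ : ℝ) + k₂) / T))) :=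
    ((continuous_id.mul continuous_const).tendsto 1).mono_left nhdsWithin_le_nhds
  rw [one_mul] at hlim
  refine le_of_tendsto hlim ?_
  filter_upwards [Ioo_mem_nhdsLT (show (0 : ℝ) < 1 by norm_num)] with θ hθ
  exact key θ hθ.1 hθ.2

end TwoHopIC

namespace TwoHopIC

variable {n m f nb : ℕ}

/-- A relay can multiplex bits `u` for its destination and bits `φ` for its source. -/
theorem exists_multiplexer {β γ : Type} [Fintype β] [Fintype γ] (hβ : Fintype.card β ≤ f)
    (hγ : Fintype.card γ ≤ nb) (h : Fintype.card β + Fintype.card γ ≤ max f nb) :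
    ∃ p : (β → ZMod 2) → (γ → ZMod 2) → BSig f nb 0,
      (∀ u φ u' φ', bwd f nb f (p u φ) = bwd f nb f (p u' φ') → u = u') ∧
      (∀ u φ u' φ', bwd f nb nb (p u φ) = bwd f nb nb (p u' φ') → φ = φ') := by
  have hκ : ∃ κ : β ⊕ γ → ℕ, Function.Injective κ ∧ (∀ b, κ (.inl b) < f) ∧
      ∀ c, κ (.inr c) < nb := by
    let eβ := Fintype.equivFin β
    let eγ := Fintype.equivFin γ
    have iβ : ∀ b b', (eβ b : ℕ) = eβ b' → b = b' := fun b b' hb => eβ.injective (Fin.ext hb)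
    have iγ : ∀ b b', (eγ b : ℕ) = eγ b' → b = b' := fun b b' hb => eγ.injective (Fin.ext hb)
    have lβ : ∀ b, (eβ b : ℕ) < Fintype.card β := fun b => (eβ b).isLt
    have lγ : ∀ b, (eγ b : ℕ) < Fintype.card γ := fun b => (eγ b).isLt
    rcases le_total nb f with hf | hf
    · refine ⟨Sum.elim (fun b => Fintype.card γ + eβ b) (fun c => eγ c), ?_, ?_, ?_⟩
      · rintro (b | b) (b' | b') hb <;> simp only [Sum.elim_inl, Sum.elim_inr] at hb
        · rw [iβ b b' (by omega)]
        · have := lγ b'; omega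
        · have := lγ b; omega
        · rw [iγ b b' hb]
      · intro b; have := lβ b; simp only [Sum.elim_inl]; omega
      · intro c; have := lγ c; simp only [Sum.elim_inr]; omega
    · refine ⟨Sum.elim (fun b => eβ b) (fun c => Fintype.card β + eγ c), ?_, ?_, ?_⟩
      · rintro (b | b) (b' | b') hb <;> simp only [Sum.elim_inl, Sum.elim_inr] at hb
        · rw [iβ b b' hb]
        · have := lβ b; omega
        · have := lβ b'; omega
        · rw [iγ b b' (by omega)]
      · intro b; have := lβ b; simp only [Sum.elim_inl]; omega
      · intro c; have := lγ c; simp only [Sum.elim_inr]; omega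
  obtain ⟨κ, hinj, hf, hnb⟩ := hκ
  refine ⟨fun u φ i => Function.extend κ (Sum.elim u φ) 0 i, ?_, ?_⟩
  · intro u φ u' φ' he
    rw [bwd_eq_iff _ _ _ (le_max_right _ _)] at he
    funext b
    have := he _ (hf b)
    rw [extend_mk, extend_mk, if_pos (by have := hf b; omega), if_pos (by have := hf b; omega),
      hinj.extend_apply, hinj.extend_apply] at this
    exact this
  · intro u φ u' φ' he
    rw [bwd_eq_iff _ _ _ (le_max_left _ _)] at he
    funext b
    have := he _ (hnb b)
    rw [extend_mk, extend_mk, if_pos (by have := hnb b; omega), if_pos (by have := hnb b; omega),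
      hinj.extend_apply, hinj.extend_apply] at this
    exact this

/-- Source signal carrying fresh bits `A` and, on the levels `J`, the bits `B` of the other
source with delay two. -/
def sig (J : Finset ℕ) (A B : ℕ → ℕ → ZMod 2) (t j : ℕ) : ZMod 2 :=
  A t j + if j ∈ J ∧ 2 ≤ t then B (t - 2) j else 0

/-- The signal at the relay of a source with fresh bits `A`, under interference from a source
with fresh bits `B`. -/
def rx (n m : ℕ) (J J' : Finset ℕ) (A B : ℕ → ℕ → ZMod 2) (t : ℕ) : FSig n m :=
  fwd n m (fun j => sig J A B t j) (fun j => sig J' B A t j)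

/-- A relay hears at the levels `h + j`, `j ∈ J`, enough for its source to learn the
interfering bits on `J`, and it can decode all fresh bits of its source within two steps. -/
structure Resolves (n m h : ℕ) (Λ Λ' J J' : Finset ℕ) : Prop where
  feedback : ∀ A B : ℕ → ℕ → ZMod 2, (∀ t, ∀ j ∉ Λ, A t j = 0) → (∀ t, ∀ j ∉ Λ', B t j = 0) →
    ∀ t, ∀ j ∈ J, extend (rx n m J J' A B t) (h + j) = A t (h + j) + B t j
  decode : ∀ A B A' B' : ℕ → ℕ → ZMod 2, (∀ t, ∀ j ∉ Λ, A t j = 0) →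
    (∀ t, ∀ j ∉ Λ', B t j = 0) → (∀ t, ∀ j ∉ Λ, A' t j = 0) → (∀ t, ∀ j ∉ Λ', B' t j = 0) →
    ∀ t, (∀ s ≤ t + 2, rx n m J J' A B s = rx n m J J' A' B' s) → ∀ j ∈ Λ, A t j = A' t j

/-- The bits of a message, indexed by time and level, padded by zeros. -/
def bits {K : ℕ} {Λ : Finset ℕ} (w : Fin K → Λ → ZMod 2) (t j : ℕ) : ZMod 2 :=
  if h : t < K ∧ j ∈ Λ then w ⟨t, h.1⟩ ⟨j, h.2⟩ else 0

theorem bits_of_notMem {K : ℕ} {Λ : Finset ℕ} (w : Fin K → Λ → ZMod 2) (t : ℕ) :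
    ∀ j ∉ Λ, bits w t j = 0 := fun _ hj => dif_neg fun h => hj h.2

theorem bits_injective {K : ℕ} {Λ : Finset ℕ} {w w' : Fin K → Λ → ZMod 2}
    (h : ∀ t < K, ∀ j ∈ Λ, bits w t j = bits w' t j) : w = w' := by
  funext t j
  have := h t t.isLt j j.2
  simpa [bits] using this

/-- The signal of a relay: the fresh bits decoded with delay three, and the feedback. -/
def relaySignal {Λ J : Finset ℕ} (p : (Λ → ZMod 2) → (J → ZMod 2) → BSig f nb 0) (h : ℕ)
    (A : ℕ → ℕ → ZMod 2) (y : ℕ → FSig n m) (t : ℕ) : BSig f nb 0 :=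
  p (fun j => if 3 ≤ t then A (t - 3) j else 0)
    (fun j => if 1 ≤ t then extend (y (t - 1)) (h + j) else 0)

theorem Resolves.sig_eq {h : ℕ} {Λ Λ' J J' : Finset ℕ} (hR : Resolves n m h Λ Λ' J J')
    {p : (Λ → ZMod 2) → (J → ZMod 2) → BSig f nb 0}
    (hp : ∀ u φ u' φ', bwd f nb nb (p u φ) = bwd f nb nb (p u' φ') → φ = φ')
    {A B B' : ℕ → ℕ → ZMod 2} (hA : ∀ t, ∀ j ∉ Λ, A t j = 0)
    (hB : ∀ t, ∀ j ∉ Λ', B t j = 0) (hB' : ∀ t, ∀ j ∉ Λ', B' t j = 0) (t : ℕ)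
    (he : ∀ s < t, bwd f nb nb (relaySignal p h A (rx n m J J' A B) s) =
      bwd f nb nb (relaySignal p h A (rx n m J J' A B') s)) (j : ℕ) :
    sig J A B t j = sig J A B' t j := by
  unfold sig
  split_ifs with hj
  · have h1 := congrFun (hp _ _ _ _ (he (t - 1) (by omega))) ⟨j, hj.1⟩
    simp only [show 1 ≤ t - 1 by omega, if_true, show t - 1 - 1 = t - 2 by omega] at h1
    rw [hR.feedback A B hA hB _ _ hj.1, hR.feedback A B' hA hB' _ _ hj.1] at h1
    rw [add_left_cancel h1]
  · rfl

theorem Resolves.relaySignal_eq {h : ℕ} {Λ Λ' J J' : Finset ℕ}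
    (hR : Resolves n m h Λ Λ' J J') {p : (Λ → ZMod 2) → (J → ZMod 2) → BSig f nb 0}
    {A B A' B' : ℕ → ℕ → ZMod 2} (hA : ∀ t, ∀ j ∉ Λ, A t j = 0)
    (hB : ∀ t, ∀ j ∉ Λ', B t j = 0) (hA' : ∀ t, ∀ j ∉ Λ, A' t j = 0)
    (hB' : ∀ t, ∀ j ∉ Λ', B' t j = 0) (t : ℕ)
    (he : ∀ s < t, rx n m J J' A B s = rx n m J J' A' B' s) :
    relaySignal p h A (rx n m J J' A B) t = relaySignal p h A' (rx n m J J' A' B') t := by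
  unfold relaySignal
  congr 1
  · funext j
    split_ifs with ht
    · exact hR.decode A B A' B' hA hB hA' hB' (t - 3) (fun s hs => he s (by omega)) j j.2
    · rfl
  · funext j
    split_ifs with ht
    · rw [he (t - 1) (by omega)]
    · rfl

theorem bits_eq_of_dest {K h : ℕ} {Λ J : Finset ℕ}
    {p : (Λ → ZMod 2) → (J → ZMod 2) → BSig f nb 0}
    (hp : ∀ u φ u' φ', bwd f nb f (p u φ) = bwd f nb f (p u' φ') → u = u')
    {w w' : Fin K → Λ → ZMod 2} {y y' : ℕ → FSig n m}
    (he : ∀ t < 1 * K + 3, bwd f nb f (relaySignal p h (bits w) y t) =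
      bwd f nb f (relaySignal p h (bits w') y' t)) : w = w' := by
  refine bits_injective fun t ht j hj => ?_
  simpa using congrFun (hp _ _ _ _ (he (t + 3) (by omega))) ⟨j, hj⟩

/-- The feedback scheme: zero-error communication of `K` symbols in `K + 3` channel uses. -/
theorem feedbackScheme {h : ℕ} {Λ₁ Λ₂ J₁ J₂ : Finset ℕ} (h₁ : Resolves n m h Λ₁ Λ₂ J₁ J₂)
    (h₂ : Resolves n m h Λ₂ Λ₁ J₂ J₁) (hΛ₁ : Λ₁.card ≤ f) (hΛ₂ : Λ₂.card ≤ f)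
    (hJ₁ : J₁.card ≤ nb) (hJ₂ : J₂.card ≤ nb) (hF₁ : Λ₁.card + J₁.card ≤ max f nb)
    (hF₂ : Λ₂.card + J₂.card ≤ max f nb) (K : ℕ) :
    Nonempty (ZeroErrorScheme n m f nb (1 * K + 3) (Fin K → Λ₁ → ZMod 2)
      (Fin K → Λ₂ → ZMod 2)) := by
  obtain ⟨p₁, hp₁, hq₁⟩ := exists_multiplexer (f := f) (nb := nb) (β := Λ₁) (γ := J₁)
    (by simpa) (by simpa) (by simpa only [Fintype.card_coe])
  obtain ⟨p₂, hp₂, hq₂⟩ := exists_multiplexer (f := f) (nb := nb) (β := Λ₂) (γ := J₂)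
    (by simpa) (by simpa) (by simpa only [Fintype.card_coe])
  exact ⟨{
    x₁ := fun a b t j => sig J₁ (bits a) (bits b) t j
    x₂ := fun a b t j => sig J₂ (bits b) (bits a) t j
    r₁ := fun a b => relaySignal p₁ h (bits a) (rx n m J₁ J₂ (bits a) (bits b))
    r₂ := fun a b => relaySignal p₂ h (bits b) (rx n m J₂ J₁ (bits b) (bits a))
    source₁ := fun a b b' t he => funext fun j => h₁.sig_eq hq₁ (bits_of_notMem _)
      (bits_of_notMem _) (bits_of_notMem _) t he j
    source₂ := fun a a' b t he => funext fun j => h₂.sig_eq hq₂ (bits_of_notMem _)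
      (bits_of_notMem _) (bits_of_notMem _) t he j
    relay₁ := fun a b a' b' t he => h₁.relaySignal_eq (bits_of_notMem _) (bits_of_notMem _)
      (bits_of_notMem _) (bits_of_notMem _) t he
    relay₂ := fun a b a' b' t he => h₂.relaySignal_eq (bits_of_notMem _) (bits_of_notMem _)
      (bits_of_notMem _) (bits_of_notMem _) t he
    dest₁ := fun a b a' b' he => bits_eq_of_dest hp₁ he
    dest₂ := fun a b a' b' he => bits_eq_of_dest hp₂ he }⟩

theorem le_sumCapacity_of_resolves {h : ℕ} {Λ₁ Λ₂ J₁ J₂ : Finset ℕ}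
    (hb : BddAbove {r : ℝ | ∃ R1 R2 : ℝ, Achievable n m f nb 0 R1 R2 ∧ r = R1 + R2})
    (h₁ : Resolves n m h Λ₁ Λ₂ J₁ J₂)
    (h₂ : Resolves n m h Λ₂ Λ₁ J₂ J₁) (hΛ₁ : Λ₁.card ≤ f) (hΛ₂ : Λ₂.card ≤ f)
    (hJ₁ : J₁.card ≤ nb) (hJ₂ : J₂.card ≤ nb) (hF₁ : Λ₁.card + J₁.card ≤ max f nb)
    (hF₂ : Λ₂.card + J₂.card ≤ max f nb) :
    ((Λ₁.card + Λ₂.card : ℕ) : ℝ) ≤ sumCapacity n m f nb 0 := by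
  have := le_sumCapacity_of_schemes (n := n) (m := m) (f := f) (nb := nb) 1 3 Λ₁.card Λ₂.card
    one_pos hb fun K => ⟨_, _, inferInstance, inferInstance, ?_, ?_,
      feedbackScheme h₁ h₂ hΛ₁ hΛ₂ hJ₁ hJ₂ hF₁ hF₂ K⟩
  · simpa using this
  · simp [← pow_mul, mul_comm]
  · simp [← pow_mul, mul_comm]

/-- Decoding with weak interference: `J` and `J'` consist of levels whose interference chain has
length two. -/
theorem resolves_weak (hnm : 3 * m ≤ 2 * n) {Λ Λ' J J' : Finset ℕ} (hJJ : Disjoint J J')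
    (hJ : ∀ j ∈ J, m - (n - m) ≤ j ∧ j < m ∧ j < n - m)
    (hJ' : ∀ j ∈ J', m - (n - m) ≤ j ∧ j < m ∧ j < n - m)
    (hΛ : ∀ j ∈ Λ, j < n ∧ j ∉ J ∧ (n - m ≤ j → j < 2 * (n - m) →
      j - (n - m) ∈ J ∨ j - (n - m) ∈ J'))
    (hΛ' : ∀ j ∈ Λ', j < n ∧ j ∉ J' ∧ (n - m ≤ j → j < 2 * (n - m) →
      j - (n - m) ∈ J ∨ j - (n - m) ∈ J')) :
    Resolves n m (n - m) Λ Λ' J J' := by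
  have hm : m ≤ n := by omega
  have hy : ∀ (A B : ℕ → ℕ → ZMod 2) (t i : ℕ), i < n → extend (rx n m J J' A B t) i =
      sig J A B t i + if n - m ≤ i then sig J' B A t (i - (n - m)) else 0 := by
    intro A B t i hi
    rw [rx, extend_fwd _ _ _ _ (by omega), extend_mk, extend_mk, max_eq_right hm]
    simp only [Nat.sub_self, Nat.zero_le, if_true, Nat.sub_zero, hi]
    rw [if_pos (show i - (n - m) < n by omega)]
  have hfb : ∀ A B : ℕ → ℕ → ZMod 2, (∀ t, ∀ j ∉ Λ', B t j = 0) →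
      ∀ t, ∀ j ∈ J, extend (rx n m J J' A B t) (n - m + j) = A t (n - m + j) + B t j := by
    intro A B hB t j hj
    have h1 := hJ j hj
    rw [hy A B t _ (by omega), if_pos (by omega), Nat.add_sub_cancel_left]
    have h2 : n - m + j ∉ J := fun hc => by have := hJ _ hc; omega
    have h3 : j ∉ J' := Finset.disjoint_left.1 hJJ hj
    simp [sig, h2, h3]
  have htop : ∀ (A B : ℕ → ℕ → ZMod 2) (t j : ℕ), j < n - m →
      extend (rx n m J J' A B t) j = sig J A B t j := by
    intro A B t j hj
    rw [hy A B t j (by omega), if_neg (by omega), add_zero]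
  refine ⟨fun A B _ hB => hfb A B hB, ?_⟩
  intro A B A' B' hA hB hA' hB' t he j hj
  obtain ⟨hjn, hjJ, hjmid⟩ := hΛ j hj
  have hfresh : ∀ s ≤ t + 2, ∀ i < n - m, i ∉ J → A s i = A' s i := by
    intro s hs i hi hiJ
    have h1 := htop A B s i hi
    rw [he s hs, htop A' B' s i hi] at h1
    simpa [sig, hiJ] using h1.symm
  rcases lt_or_ge j (n - m) with h1 | h1
  · exact hfresh t (by omega) j h1 hjJ
  have hown : ∀ (A B : ℕ → ℕ → ZMod 2), sig J A B t j = A t j := by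
    intro A B; simp [sig, hjJ]
  have e := hy A B t j hjn
  rw [he t (by omega), hy A' B' t j hjn, if_pos h1, if_pos h1, hown, hown] at e
  rcases lt_or_ge j (2 * (n - m)) with h2 | h2
  · rcases hjmid h1 h2 with h3 | h3
    · have hj0 := hJ _ h3
      have h4 : j - (n - m) ∉ J' := Finset.disjoint_left.1 hJJ h3
      have h5 : ∀ (A B : ℕ → ℕ → ZMod 2), (∀ t, ∀ j ∉ Λ, A t j = 0) →
          extend (rx n m J J' A B (t + 2)) (j - (n - m)) = B t (j - (n - m)) := by
        intro A B hA
        rw [htop A B _ _ hj0.2.2]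
        simp [sig, h3, hA _ _ (fun hc => (hΛ _ hc).2.1 h3)]
      have h6 := h5 A B hA
      rw [he (t + 2) le_rfl, h5 A' B' hA'] at h6
      simp only [sig, h4, false_and, if_false, add_zero, h6] at e
      exact (add_right_cancel e).symm
    · have hj0 := hJ' _ h3
      have h4 : j - (n - m) ∉ J := Finset.disjoint_right.1 hJJ h3
      have h5 : sig J' B A t (j - (n - m)) = sig J' B' A' t (j - (n - m)) := by
        have h6 : j - (n - m) ∉ Λ' := fun hc => (hΛ' _ hc).2.1 h3
        simp only [sig, hB _ _ h6, hB' _ _ h6, zero_add]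
        split_ifs with h7
        · exact hfresh (t - 2) (by omega) _ hj0.2.2 h4
        · rfl
      rw [h5] at e
      exact (add_right_cancel e).symm
  · have h3 : j - (n - m) ∉ J' := fun hc => by have := hJ' _ hc; omega
    have h4 : j - (n - m) ∉ Λ' := by
      intro hc
      rcases (hΛ' _ hc).2.2 (by omega) (by omega) with h5 | h5
      · have := hJ _ h5; omega
      · have := hJ' _ h5; omega
    simpa [sig, h3, hB _ _ h4, hB' _ _ h4] using e.symm

/-- Decoding with strong interference: the levels in `J` and `J'` are heard only by the
unintended relay. -/
theorem resolves_strong (hm : 2 * n ≤ m) {Λ Λ' J J' : Finset ℕ} (hJJ : Disjoint J J')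
    (hJ : ∀ j ∈ J, n ≤ j ∧ j < m - n) (hJ' : ∀ j ∈ J', n ≤ j ∧ j < m - n)
    (hΛ : ∀ j ∈ Λ, j < n ∨ j ∈ J') (hΛ' : ∀ j ∈ Λ', j < n ∨ j ∈ J) :
    Resolves n m 0 Λ Λ' J J' := by
  have hy : ∀ (A B : ℕ → ℕ → ZMod 2) (t i : ℕ), i < m → extend (rx n m J J' A B t) i =
      (if m - n ≤ i then sig J A B t (i - (m - n)) else 0) + sig J' B A t i := by
    intro A B t i hi
    rw [rx, extend_fwd _ _ _ _ (by omega), extend_mk, extend_mk, max_eq_left (by omega)]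
    simp only [Nat.sub_self, Nat.zero_le, if_true, Nat.sub_zero, hi]
    rw [if_pos (show i - (m - n) < m by omega)]
  have hmid : ∀ (A B : ℕ → ℕ → ZMod 2) (t j : ℕ), j < m - n →
      extend (rx n m J J' A B t) j = sig J' B A t j := by
    intro A B t j hj
    rw [hy A B t j (by omega), if_neg (by omega), zero_add]
  refine ⟨?_, ?_⟩
  · intro A B hA hB t j hj
    have h3 : j ∉ J' := Finset.disjoint_left.1 hJJ hj
    have h4 : j ∉ Λ := fun hc => by
      rcases hΛ _ hc with h | h
      · have := hJ _ hj; omega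
      · exact h3 h
    rw [Nat.zero_add, hmid A B t j (hJ _ hj).2, hA _ _ h4]
    simp [sig, h3]
  · intro A B A' B' hA hB hA' hB' t he j hj
    rcases hΛ j hj with h1 | h1
    · have hown : ∀ A B : ℕ → ℕ → ZMod 2, (∀ t, ∀ j ∉ Λ', B t j = 0) →
          extend (rx n m J J' A B t) (m - n + j) = A t j := by
        intro A B hB
        have h2 : m - n + j ∉ J' := fun hc => by have := hJ' _ hc; omega
        have h3 : m - n + j ∉ Λ' := fun hc => by
          rcases hΛ' _ hc with h | h
          · omega
          · have := hJ _ h; omega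
        have h4 : j ∉ J := fun hc => by have := hJ _ hc; omega
        rw [hy A B t _ (by omega), if_pos (by omega), Nat.add_sub_cancel_left]
        simp [sig, h2, h4, hB _ _ h3]
      rw [← hown A B hB, he t (by omega), hown A' B' hB']
    · have h2 := hJ' _ h1
      have h3 : j ∉ Λ' := fun hc => by
        rcases hΛ' _ hc with h | h
        · omega
        · exact Finset.disjoint_left.1 hJJ h h1
      have h4 : ∀ A B : ℕ → ℕ → ZMod 2, (∀ t, ∀ j ∉ Λ', B t j = 0) →
          extend (rx n m J J' A B (t + 2)) j = A t j := by
        intro A B hB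
        rw [hmid A B _ _ h2.2]
        simp [sig, h1, hB _ _ h3]
      rw [← h4 A B hB, he (t + 2) le_rfl, h4 A' B' hB']

end TwoHopIC

namespace TwoHopIC

variable {n m f nb : ℕ}

theorem le_sumCapacity_weak_of_split (hnm : 3 * m ≤ 2 * n)
    (hb : BddAbove {r : ℝ | ∃ R1 R2 : ℝ, Achievable n m f nb 0 R1 R2 ∧ r = R1 + R2})
    {k₁ k₂ c₁ c₂ : ℕ} (hk₁ : k₁ ≤ max (n - m) m + c₁) (hk₂ : k₂ ≤ max (n - m) m + c₂)
    (hc : c₁ + c₂ + 2 * max (n - m) m ≤ 2 * n - m) (hf₁ : k₁ ≤ f) (hf₂ : k₂ ≤ f)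
    (hn₁ : c₁ ≤ nb) (hn₂ : c₂ ≤ nb) (hF₁ : k₁ + c₂ ≤ max f nb) (hF₂ : k₂ + c₁ ≤ max f nb) :
    ((k₁ + k₂ : ℕ) : ℝ) ≤ sumCapacity n m f nb 0 := by
  set d := n - m with hd
  set g := m - d with hg
  let J₂ := Finset.Ico g (g + c₁)
  let J₁ := Finset.Ico (g + c₁) (g + c₁ + c₂)
  have hJ₁ : ∀ j ∈ J₁, m - (n - m) ≤ j ∧ j < m ∧ j < n - m := fun j hj => by
    have := Finset.mem_Ico.1 hj; omega
  have hJ₂ : ∀ j ∈ J₂, m - (n - m) ≤ j ∧ j < m ∧ j < n - m := fun j hj => by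
    have := Finset.mem_Ico.1 hj; omega
  have hdis : Disjoint J₁ J₂ := (Finset.Ico_disjoint_Ico_consecutive _ _ _).symm
  have fresh : ∀ J : Finset ℕ, (∀ j ∈ J, m - (n - m) ≤ j ∧ j < m ∧ j < n - m) →
      ∀ k, k + J.card ≤ max d m + (c₁ + c₂) → ∃ Λ : Finset ℕ, Λ.card = k ∧
        ∀ j ∈ Λ, j < n ∧ j ∉ J ∧ (n - m ≤ j → j < 2 * (n - m) →
          j - (n - m) ∈ J₁ ∨ j - (n - m) ∈ J₂) := by
    intro J hJ k hk
    have hJd : J ⊆ Finset.range d := fun j hj => Finset.mem_range.2 (hJ j hj).2.2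
    have hcard : k ≤ ((Finset.range d \ J) ∪
        (Finset.Ico (d + g) (d + g + c₁ + c₂) ∪ Finset.Ico (2 * d) n)).card := by
      have hle := Finset.card_le_card hJd
      rw [Finset.card_range] at hle
      rw [Finset.card_union_of_disjoint, Finset.card_union_of_disjoint,
        Finset.card_sdiff_of_subset hJd, Finset.card_range, Nat.card_Ico, Nat.card_Ico]
      · omega
      · rw [Finset.disjoint_left]
        intro j h1 h2
        rw [Finset.mem_Ico] at h1 h2
        omega
      · rw [Finset.disjoint_left]
        intro j h1 h2
        simp only [Finset.mem_sdiff, Finset.mem_range, Finset.mem_union, Finset.mem_Ico] at h1 h2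
        omega
    obtain ⟨Λ, hΛ, hΛk⟩ := Finset.exists_subset_card_eq hcard
    refine ⟨Λ, hΛk, fun j hj => ?_⟩
    have h1 := hΛ hj
    simp only [Finset.mem_sdiff, Finset.mem_range, Finset.mem_union, Finset.mem_Ico] at h1
    refine ⟨by omega, ?_, ?_⟩
    · rcases h1 with h1 | h1
      · exact h1.2
      · intro hc
        have := hJ j hc
        omega
    · intro h2 h3
      simp only [J₁, J₂, Finset.mem_Ico]
      omega
  have hcJ₁ : J₁.card = c₂ := by simp [J₁]
  have hcJ₂ : J₂.card = c₁ := by simp [J₂]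
  obtain ⟨Λ₁, hk₁', hΛ₁⟩ := fresh J₁ hJ₁ k₁ (by omega)
  obtain ⟨Λ₂, hk₂', hΛ₂⟩ := fresh J₂ hJ₂ k₂ (by omega)
  have := le_sumCapacity_of_resolves hb
    (resolves_weak hnm hdis hJ₁ hJ₂ hΛ₁ hΛ₂)
    (resolves_weak hnm hdis.symm hJ₂ hJ₁ (fun j hj => ⟨(hΛ₂ j hj).1, (hΛ₂ j hj).2.1,
      fun h h' => ((hΛ₂ j hj).2.2 h h').symm⟩) (fun j hj => ⟨(hΛ₁ j hj).1, (hΛ₁ j hj).2.1,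
      fun h h' => ((hΛ₁ j hj).2.2 h h').symm⟩))
    (by omega) (by omega) (by omega) (by omega) (by omega) (by omega)
  rwa [hk₁', hk₂'] at this

theorem le_sumCapacity_strong_of_split (hnm : 2 * n ≤ m)
    (hb : BddAbove {r : ℝ | ∃ R1 R2 : ℝ, Achievable n m f nb 0 R1 R2 ∧ r = R1 + R2})
    {k₁ k₂ c₁ c₂ : ℕ} (hk₁ : k₁ ≤ n + c₁) (hk₂ : k₂ ≤ n + c₂)
    (hc : c₁ + c₂ + 2 * n ≤ m) (hf₁ : k₁ ≤ f) (hf₂ : k₂ ≤ f)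
    (hn₁ : c₁ ≤ nb) (hn₂ : c₂ ≤ nb) (hF₁ : k₁ + c₂ ≤ max f nb) (hF₂ : k₂ + c₁ ≤ max f nb) :
    ((k₁ + k₂ : ℕ) : ℝ) ≤ sumCapacity n m f nb 0 := by
  let J₂ := Finset.Ico n (n + c₁)
  let J₁ := Finset.Ico (n + c₁) (n + c₁ + c₂)
  have hJ₁ : ∀ j ∈ J₁, n ≤ j ∧ j < m - n := fun j hj => by
    have := Finset.mem_Ico.1 hj; omega
  have hJ₂ : ∀ j ∈ J₂, n ≤ j ∧ j < m - n := fun j hj => by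
    have := Finset.mem_Ico.1 hj; omega
  have hdis : Disjoint J₁ J₂ := (Finset.Ico_disjoint_Ico_consecutive _ _ _).symm
  have fresh : ∀ J : Finset ℕ, (∀ j ∈ J, n ≤ j ∧ j < m - n) → ∀ k ≤ n + J.card,
      ∃ Λ : Finset ℕ, Λ.card = k ∧ ∀ j ∈ Λ, j < n ∨ j ∈ J := by
    intro J hJ k hk
    have hcard : k ≤ (Finset.range n ∪ J).card := by
      rw [Finset.card_union_of_disjoint, Finset.card_range]
      · exact hk
      · rw [Finset.disjoint_left]
        intro j h1 h2
        have := hJ j h2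
        rw [Finset.mem_range] at h1
        omega
    obtain ⟨Λ, hΛ, hΛk⟩ := Finset.exists_subset_card_eq hcard
    exact ⟨Λ, hΛk, fun j hj => by simpa using hΛ hj⟩
  have hcJ₁ : J₁.card = c₂ := by simp [J₁]
  have hcJ₂ : J₂.card = c₁ := by simp [J₂]
  obtain ⟨Λ₁, hk₁', hΛ₁⟩ := fresh J₂ hJ₂ k₁ (by omega)
  obtain ⟨Λ₂, hk₂', hΛ₂⟩ := fresh J₁ hJ₁ k₂ (by omega)
  have := le_sumCapacity_of_resolves hb (resolves_strong hnm hdis hJ₁ hJ₂ hΛ₁ hΛ₂)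
    (resolves_strong hnm hdis.symm hJ₂ hJ₁ hΛ₂ hΛ₁)
    (by omega) (by omega) (by omega) (by omega) (by omega) (by omega)
  rwa [hk₁', hk₂'] at this

theorem le_sumCapacity_weak (hnm : 3 * m ≤ 2 * n)
    (hb : BddAbove {r : ℝ | ∃ R1 R2 : ℝ, Achievable n m f nb 0 R1 R2 ∧ r = R1 + R2})
    {S : ℕ} (h₁ : S ≤ max f nb + max (n - m) m) (h₂ : S ≤ 2 * max (n - m) m + 2 * nb)
    (h₃ : S ≤ 2 * n - m) (h₄ : S ≤ 2 * f) : (S : ℝ) ≤ sumCapacity n m f nb 0 := by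
  rcases le_total S (2 * max (n - m) m) with h | h
  · have := le_sumCapacity_weak_of_split hnm hb (k₁ := S / 2) (k₂ := S - S / 2) (c₁ := 0)
      (c₂ := 0) (by omega) (by omega) (by omega) (by omega) (by omega) (by omega) (by omega)
      (by omega) (by omega)
    rwa [show S / 2 + (S - S / 2) = S by omega] at this
  · obtain ⟨e, rfl⟩ := Nat.exists_eq_add_of_le h
    have := le_sumCapacity_weak_of_split hnm hb (k₁ := max (n - m) m + e / 2)
      (k₂ := max (n - m) m + (e - e / 2)) (c₁ := e / 2)
      (c₂ := e - e / 2) (by omega) (by omega) (by omega) (by omega) (by omega) (by omega)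
      (by omega) (by omega) (by omega)
    rwa [show max (n - m) m + e / 2 + (max (n - m) m + (e - e / 2)) = 2 * max (n - m) m + e by
      omega] at this

theorem le_sumCapacity_strong (hnm : 2 * n ≤ m)
    (hb : BddAbove {r : ℝ | ∃ R1 R2 : ℝ, Achievable n m f nb 0 R1 R2 ∧ r = R1 + R2})
    {S : ℕ} (h₁ : S ≤ max f nb + n) (h₂ : S ≤ 2 * n + 2 * nb)
    (h₃ : S ≤ m) (h₄ : S ≤ 2 * f) : (S : ℝ) ≤ sumCapacity n m f nb 0 := by
  rcases le_total S (2 * n) with h | h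
  · have := le_sumCapacity_strong_of_split hnm hb (k₁ := S / 2) (k₂ := S - S / 2) (c₁ := 0)
      (c₂ := 0) (by omega) (by omega) (by omega) (by omega) (by omega) (by omega) (by omega)
      (by omega) (by omega)
    rwa [show S / 2 + (S - S / 2) = S by omega] at this
  · obtain ⟨e, rfl⟩ := Nat.exists_eq_add_of_le h
    have := le_sumCapacity_strong_of_split hnm hb (k₁ := n + e / 2)
      (k₂ := n + (e - e / 2)) (c₁ := e / 2)
      (c₂ := e - e / 2) (by omega) (by omega) (by omega) (by omega) (by omega) (by omega)
      (by omega) (by omega) (by omega)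
    rwa [show n + e / 2 + (n + (e - e / 2)) = 2 * n + e by omega] at this

end TwoHopIC

namespace TwoHopIC

/-- Kernel size of a homomorphism that is onto a set of coordinates. -/
theorem ncard_ker_mul_le {V ι κ : Type} [AddCommGroup V] [Fintype V] [Fintype κ]
    (φ : V →+ (ι → ZMod 2)) (σ : κ → ι) (h : ∀ y : κ → ZMod 2, ∃ v, ∀ k, φ v (σ k) = y k) :
    {v | φ v = 0}.ncard * 2 ^ Fintype.card κ ≤ Fintype.card V := by
  let ψ : V →+ (κ → ZMod 2) := AddMonoidHom.mk' (fun v k => φ v (σ k)) (by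
    intro a b; funext k; simp)
  have hψ : Function.Surjective ψ := fun y => by
    obtain ⟨v, hv⟩ := h y
    exact ⟨v, funext hv⟩
  have hle : {v | φ v = 0}.ncard ≤ (Finset.univ.filter fun v => ψ v = 0).card := by
    rw [← Set.ncard_coe_finset]
    refine Set.ncard_le_ncard (fun v hv => ?_) (Set.toFinite _)
    simp only [Finset.coe_filter, Finset.mem_univ, true_and, Set.mem_ofPred_eq] at hv ⊢
    funext k
    simp [ψ, hv]
  have hV : Fintype.card V = (Finset.univ.filter fun v => ψ v = 0).card * 2 ^ Fintype.card κ := by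
    rw [← Finset.card_univ, Finset.card_eq_sum_card_fiberwise (f := ψ) (t := Finset.univ)
      (fun _ _ => Finset.mem_coe.2 (Finset.mem_univ _)),
      Finset.sum_congr rfl fun y _ => AddMonoidHom.card_fiber_eq_of_mem_range ψ (hψ y) (hψ 0)]
    simp [mul_comm]
  rw [hV]
  exact Nat.mul_le_mul_right _ hle

/-- Union bound over a family of rare events. -/
theorem ncard_exists_le {V E : Type} [Fintype V] [Fintype E] (P : E → V → Prop) {W : ℕ}
    (hP : ∀ e, {v | P e v}.ncard * W ≤ Fintype.card V)
    (hE : 8 * Fintype.card E ≤ W) :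
    8 * {v | ∃ e, P e v}.ncard ≤ Fintype.card V := by
  have h1 : {v | ∃ e, P e v}.ncard ≤ ∑ e, {v | P e v}.ncard := by
    have : {v | ∃ e, P e v} = ⋃ e ∈ (Finset.univ : Finset E), {v | P e v} := by
      ext v; simp
    rw [this]
    exact Finset.set_ncard_biUnion_le _ _
  have h2 : (∑ e, {v | P e v}.ncard) * W ≤ Fintype.card E * Fintype.card V := by
    rw [Finset.sum_mul]
    exact (Finset.sum_le_sum fun e _ => hP e).trans (by simp)
  rcases Nat.eq_zero_or_pos (Fintype.card E) with h0 | h0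
  · have : IsEmpty E := Fintype.card_eq_zero_iff.1 h0
    simp
  · have h3 := Nat.mul_le_mul_left {v | ∃ e, P e v}.ncard hE
    have h4 := Nat.mul_le_mul_right W h1
    nlinarith

section RandomCode

variable {d m T c p : ℕ}

/-- Generator matrices, one column of signal levels per channel use. -/
abbrev Gen (T q c : ℕ) := Fin T → Fin q → Fin c → ZMod 2

/-- The signal at a relay, `A` and `B` being the generators of the common and the private part
of its source and `A'` the generator of the common part of the interfering source. -/
def rxGen (v : Gen T (m + d) c × Gen T (m + d) p × Gen T (m + d) c)
    (a : (Fin c → ZMod 2) × (Fin p → ZMod 2) × (Fin c → ZMod 2)) (τ : Fin T × Fin (m + d)) :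
    ZMod 2 :=
  ∑ j, v.1 τ.1 τ.2 j * a.1 j + (if m ≤ τ.2 then ∑ j, v.2.1 τ.1 τ.2 j * a.2.1 j else 0) +
    if d ≤ τ.2 then ∑ j, v.2.2 τ.1 ⟨τ.2 - d, by omega⟩ j * a.2.2 j else 0

theorem rxGen_add_left (v v' : Gen T (m + d) c × Gen T (m + d) p × Gen T (m + d) c)
    (a : (Fin c → ZMod 2) × (Fin p → ZMod 2) × (Fin c → ZMod 2)) :
    rxGen (v + v') a = rxGen v a + rxGen v' a := by
  funext τ
  simp only [rxGen, Prod.fst_add, Prod.snd_add, Pi.add_apply, add_mul, Finset.sum_add_distrib]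
  split_ifs <;> ring

theorem rxGen_sub_right (v : Gen T (m + d) c × Gen T (m + d) p × Gen T (m + d) c)
    (a a' : (Fin c → ZMod 2) × (Fin p → ZMod 2) × (Fin c → ZMod 2)) :
    rxGen v (a - a') = rxGen v a - rxGen v a' := by
  funext τ
  simp only [rxGen, Prod.fst_sub, Prod.snd_sub, Pi.sub_apply, mul_sub, Finset.sum_sub_distrib]
  split_ifs <;> ring

/-- The signal at a relay as a homomorphism in the generators. -/
def rxHom {V : Type} [AddCommGroup V]
    (π : V →+ Gen T (m + d) c × Gen T (m + d) p × Gen T (m + d) c)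
    (a : (Fin c → ZMod 2) × (Fin p → ZMod 2) × (Fin c → ZMod 2)) :
    V →+ (Fin T × Fin (m + d) → ZMod 2) :=
  AddMonoidHom.mk' (fun v => rxGen (π v) a) fun v v' => by rw [map_add, rxGen_add_left]

@[simp]
theorem rxHom_apply {V : Type} [AddCommGroup V]
    (π : V →+ Gen T (m + d) c × Gen T (m + d) p × Gen T (m + d) c)
    (a : (Fin c → ZMod 2) × (Fin p → ZMod 2) × (Fin c → ZMod 2)) (v : V) :
    rxHom π a v = rxGen (π v) a := rfl

theorem exists_gen_mul_eq {q k : ℕ} {u : Fin k → ZMod 2} (hu : u ≠ 0)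
    (y : Fin T → Fin q → ZMod 2) :
    ∃ A : Gen T q k, ∀ τ i, ∑ j, A τ i j * u j = y τ i := by
  obtain ⟨j, hj⟩ := Function.ne_iff.1 hu
  have hj1 : u j = 1 := by
    have : ∀ z : ZMod 2, z ≠ 0 → z = 1 := by decide
    exact this _ hj
  refine ⟨fun τ i => Pi.single j (y τ i), fun τ i => ?_⟩
  rw [Finset.sum_eq_single j]
  · simp [hj1]
  · intro b _ hb
    simp [hb]
  · simp

/-- The generators for which some pair of messages with nonzero own common part produces the
zero signal are rare; similarly for the two other parts below. -/
theorem ncard_bad_common_le {V : Type} [AddCommGroup V] [Fintype V]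
    (π : V →+ Gen T (m + d) c × Gen T (m + d) p × Gen T (m + d) c)
    (hπ : Function.Surjective π) (h₁ : 8 * 2 ^ (2 * c + p) ≤ 2 ^ ((m + d) * T)) :
    8 * {v | ∃ a : (Fin c → ZMod 2) × (Fin p → ZMod 2) × (Fin c → ZMod 2),
      a.1 ≠ 0 ∧ rxGen (π v) a = 0}.ncard ≤ Fintype.card V := by
  refine ncard_exists_le (W := 2 ^ ((m + d) * T))
    (fun (a : (Fin c → ZMod 2) × (Fin p → ZMod 2) × (Fin c → ZMod 2)) v =>
      a.1 ≠ 0 ∧ rxGen (π v) a = 0) (fun a => ?_) ?_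
  · by_cases ha : a.1 = 0
    · simp [ha]
    · have := ncard_ker_mul_le (rxHom π a) (κ := Fin T × Fin (m + d)) id fun y => ?_
      · rw [Fintype.card_prod, Fintype.card_fin, Fintype.card_fin, mul_comm T] at this
        simpa [ha] using this
      · obtain ⟨A, hA⟩ := exists_gen_mul_eq ha fun τ i => y (τ, i)
        obtain ⟨v, hv⟩ := hπ (A, 0, 0)
        exact ⟨v, fun k => by simp [rxHom, hv, rxGen, hA]⟩
  · rw [Fintype.card_prod, Fintype.card_prod, Fintype.card_fun, Fintype.card_fun, ZMod.card,
      Fintype.card_fin, Fintype.card_fin, ← pow_add, ← pow_add]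
    exact (by ring : 8 * 2 ^ (c + (p + c)) = 8 * 2 ^ (2 * c + p)).trans_le h₁

theorem ncard_bad_interference_le {V : Type} [AddCommGroup V] [Fintype V]
    (π : V →+ Gen T (m + d) c × Gen T (m + d) p × Gen T (m + d) c)
    (hπ : Function.Surjective π) (h₂ : 8 * 2 ^ (p + c) ≤ 2 ^ (m * T)) :
    8 * {v | ∃ a : (Fin p → ZMod 2) × (Fin c → ZMod 2),
      a.2 ≠ 0 ∧ rxGen (π v) (0, a) = 0}.ncard ≤ Fintype.card V := by
  refine ncard_exists_le (W := 2 ^ (m * T))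
    (fun (a : (Fin p → ZMod 2) × (Fin c → ZMod 2)) v => a.2 ≠ 0 ∧ rxGen (π v) (0, a) = 0)
    (fun a => ?_) ?_
  · by_cases ha : a.2 = 0
    · simp [ha]
    · have := ncard_ker_mul_le (rxHom π (0, a)) (κ := Fin T × Fin m)
        (fun k => (k.1, ⟨k.2 + d, by omega⟩)) fun y => ?_
      · rw [Fintype.card_prod, Fintype.card_fin, Fintype.card_fin, mul_comm T] at this
        simpa [ha] using this
      · obtain ⟨A, hA⟩ := exists_gen_mul_eq (q := m + d) ha
          fun τ i => if h : (i : ℕ) < m then y (τ, ⟨i, h⟩) else 0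
        obtain ⟨v, hv⟩ := hπ (0, 0, A)
        exact ⟨v, fun k => by simp [rxHom, hv, rxGen, hA]⟩
  · rw [Fintype.card_prod, Fintype.card_fun, Fintype.card_fun, ZMod.card,
      Fintype.card_fin, Fintype.card_fin, ← pow_add]
    exact h₂

theorem ncard_bad_private_le {V : Type} [AddCommGroup V] [Fintype V]
    (π : V →+ Gen T (m + d) c × Gen T (m + d) p × Gen T (m + d) c)
    (hπ : Function.Surjective π) (h₃ : p = 0 ∨ 8 * 2 ^ p ≤ 2 ^ (d * T)) :
    8 * {v | ∃ b : Fin p → ZMod 2, b ≠ 0 ∧ rxGen (π v) (0, b, 0) = 0}.ncard ≤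
      Fintype.card V := by
  rcases h₃ with rfl | h₃
  · simp
  refine ncard_exists_le (W := 2 ^ (d * T))
    (fun (b : Fin p → ZMod 2) v => b ≠ 0 ∧ rxGen (π v) (0, b, 0) = 0) (fun b => ?_) ?_
  · by_cases hb : b = 0
    · simp [hb]
    · have := ncard_ker_mul_le (rxHom π (0, b, 0)) (κ := Fin T × Fin d)
        (fun k => (k.1, ⟨k.2 + m, by omega⟩)) fun y => ?_
      · rw [Fintype.card_prod, Fintype.card_fin, Fintype.card_fin, mul_comm T] at this
        simpa [hb] using this
      · obtain ⟨A, hA⟩ := exists_gen_mul_eq (q := m + d) hb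
          fun τ i => if h : (i : ℕ) - m < d then y (τ, ⟨i - m, h⟩) else 0
        obtain ⟨v, hv⟩ := hπ (0, A, 0)
        exact ⟨v, fun k => by simp [rxHom, hv, rxGen, hA]⟩
  · rw [Fintype.card_fun, ZMod.card, Fintype.card_fin]
    exact h₃

/-- The generators for which some nonzero triple of messages produces the zero signal are
rare. -/
theorem ncard_bad_gen_le {V : Type} [AddCommGroup V] [Fintype V]
    (π : V →+ Gen T (m + d) c × Gen T (m + d) p × Gen T (m + d) c)
    (hπ : Function.Surjective π) (h₁ : 8 * 2 ^ (2 * c + p) ≤ 2 ^ ((m + d) * T))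
    (h₂ : 8 * 2 ^ (p + c) ≤ 2 ^ (m * T)) (h₃ : p = 0 ∨ 8 * 2 ^ p ≤ 2 ^ (d * T)) :
    8 * {v | ∃ a, a ≠ 0 ∧ rxGen (π v) a = 0}.ncard ≤ 3 * Fintype.card V := by
  have hI := ncard_bad_common_le π hπ h₁
  have hII := ncard_bad_interference_le π hπ h₂
  have hIII := ncard_bad_private_le π hπ h₃
  have hsub : {v | ∃ a, a ≠ 0 ∧ rxGen (π v) a = 0}.ncard ≤
      {v | ∃ a : (Fin c → ZMod 2) × (Fin p → ZMod 2) ×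
        (Fin c → ZMod 2), a.1 ≠ 0 ∧ rxGen (π v) a = 0}.ncard +
      ({v | ∃ a : (Fin p → ZMod 2) × (Fin c → ZMod 2),
        a.2 ≠ 0 ∧ rxGen (π v) (0, a) = 0}.ncard +
      {v | ∃ b : Fin p → ZMod 2, b ≠ 0 ∧ rxGen (π v) (0, b, 0) = 0}.ncard) := by
    refine le_trans (Set.ncard_le_ncard ?_ (Set.toFinite _)) ((Set.ncard_union_le _ _).trans
      (Nat.add_le_add_left (Set.ncard_union_le _ _) _))
    rintro v ⟨⟨u, b, u'⟩, ha, h0⟩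
    by_cases hu : u = 0
    · subst hu
      by_cases hu' : u' = 0
      · subst hu'
        exact Or.inr (Or.inr ⟨b, fun hb => ha (by rw [hb]; rfl), h0⟩)
      · exact Or.inr (Or.inl ⟨(b, u'), hu', h0⟩)
    · exact Or.inl ⟨(u, b, u'), hu, h0⟩
  omega

set_option synthInstance.maxSize 2000 in
/-- Existence of linear codes of length `T` for the interference channel without feedback, whose
private parts occupy the lowest `d` levels, such that each receiver decodes its own message and
the common part of the other one. -/
theorem exists_interference_code (h₁ : 8 * 2 ^ (2 * c + p) ≤ 2 ^ ((m + d) * T))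
    (h₂ : 8 * 2 ^ (p + c) ≤ 2 ^ (m * T)) (h₃ : p = 0 ∨ 8 * 2 ^ p ≤ 2 ^ (d * T)) :
    ∃ e₁ e₂ : (Fin c → ZMod 2) × (Fin p → ZMod 2) → Fin T → ℕ → ZMod 2,
      (∀ a b a' b', (∀ τ, ∀ i < m + d, e₁ a τ i + (if d ≤ i then e₂ b τ (i - d) else 0) =
        e₁ a' τ i + if d ≤ i then e₂ b' τ (i - d) else 0) → a = a' ∧ b.1 = b'.1) ∧
      (∀ a b a' b', (∀ τ, ∀ i < m + d, e₂ a τ i + (if d ≤ i then e₁ b τ (i - d) else 0) =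
        e₂ a' τ i + if d ≤ i then e₁ b' τ (i - d) else 0) → a = a' ∧ b.1 = b'.1) := by
  let π₁ : (Gen T (m + d) c × Gen T (m + d) p) × (Gen T (m + d) c × Gen T (m + d) p) →+
      Gen T (m + d) c × Gen T (m + d) p × Gen T (m + d) c :=
    AddMonoidHom.mk' (fun v => (v.1.1, v.1.2, v.2.1)) fun _ _ => rfl
  let π₂ : (Gen T (m + d) c × Gen T (m + d) p) × (Gen T (m + d) c × Gen T (m + d) p) →+
      Gen T (m + d) c × Gen T (m + d) p × Gen T (m + d) c :=
    AddMonoidHom.mk' (fun v => (v.2.1, v.2.2, v.1.1)) fun _ _ => rfl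
  have b₁ := ncard_bad_gen_le π₁ (fun v => ⟨((v.1, v.2.1), (v.2.2, 0)), rfl⟩) h₁ h₂ h₃
  have b₂ := ncard_bad_gen_le π₂ (fun v => ⟨((v.2.2, 0), (v.1, v.2.1)), rfl⟩) h₁ h₂ h₃
  have hpos : 0 < Fintype.card ((Gen T (m + d) c × Gen T (m + d) p) ×
    (Gen T (m + d) c × Gen T (m + d) p)) := Fintype.card_pos
  obtain ⟨v, hv⟩ : ∃ v, v ∉ {v | ∃ a, a ≠ 0 ∧ rxGen (π₁ v) a = 0} ∪
      {v | ∃ a, a ≠ 0 ∧ rxGen (π₂ v) a = 0} := by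
    by_contra! hc
    have := Set.ncard_union_le {v | ∃ a, a ≠ 0 ∧ rxGen (π₁ v) a = 0}
      {v | ∃ a, a ≠ 0 ∧ rxGen (π₂ v) a = 0}
    rw [Set.eq_univ_of_forall hc, Set.ncard_univ, Nat.card_eq_fintype_card] at this
    omega
  simp only [Set.mem_union, Set.mem_ofPred_eq, not_or, not_exists, not_and] at hv
  let e : Gen T (m + d) c × Gen T (m + d) p → (Fin c → ZMod 2) × (Fin p → ZMod 2) → Fin T → ℕ → ZMod 2 := fun g a τ i =>
    if h : i < m + d then ∑ j, g.1 τ ⟨i, h⟩ j * a.1 j +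
      (if m ≤ i then ∑ j, g.2 τ ⟨i, h⟩ j * a.2 j else 0) else 0
  have he : ∀ (g g' : Gen T (m + d) c × Gen T (m + d) p) (a b : (Fin c → ZMod 2) × (Fin p → ZMod 2)) (τ : Fin T)
      (i : Fin (m + d)), e g a τ i + (if d ≤ i then e g' b τ (i - d) else 0) =
        rxGen (g.1, g.2, g'.1) (a.1, a.2, b.1) (τ, i) := by
    intro g g' a b τ i
    simp only [e, rxGen, i.isLt, dif_pos]
    congr 1
    split_ifs with h1 h2 h3
    · omega
    · rw [add_zero]
    · omega
    · rfl
  have key : ∀ g g' : Gen T (m + d) c × Gen T (m + d) p, (∀ a, a ≠ 0 → ¬ rxGen (g.1, g.2, g'.1) a = 0) →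
      ∀ a b a' b', (∀ τ, ∀ i < m + d, e g a τ i + (if d ≤ i then e g' b τ (i - d) else 0) =
        e g a' τ i + if d ≤ i then e g' b' τ (i - d) else 0) → a = a' ∧ b.1 = b'.1 := by
    intro g g' hg a b a' b' hab
    have h0 : rxGen (g.1, g.2, g'.1) ((a.1, a.2, b.1) - (a'.1, a'.2, b'.1)) = 0 := by
      rw [rxGen_sub_right, sub_eq_zero]
      funext τ
      have := hab τ.1 τ.2 τ.2.isLt
      rwa [he, he] at this
    have h1 := sub_eq_zero.1 (not_imp_not.1 (hg _) h0)
    simp only [Prod.mk.injEq] at h1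
    exact ⟨Prod.ext h1.1 h1.2.1, h1.2.2⟩
  exact ⟨e v.1, e v.2, key _ _ hv.1, key _ _ hv.2⟩

end RandomCode

end TwoHopIC

namespace TwoHopIC

variable {n m f nb : ℕ}

/-- A block code for the first hop, forwarded by the relays with a delay of one block. -/
theorem le_sumCapacity_of_block_code {T k : ℕ} (hT : 0 < T)
    (hb : BddAbove {r : ℝ | ∃ R1 R2 : ℝ, Achievable n m f nb 0 R1 R2 ∧ r = R1 + R2})
    {α : Type} [Fintype α] (hk : 2 ^ k ≤ Fintype.card α) (hf : k ≤ T * f)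
    (e₁ e₂ : α → Fin T → FSig n m)
    (hd₁ : ∀ a b a' b', (∀ τ, fwd n m (e₁ a τ) (e₂ b τ) = fwd n m (e₁ a' τ) (e₂ b' τ)) → a = a')
    (hd₂ : ∀ a b a' b', (∀ τ, fwd n m (e₂ b τ) (e₁ a τ) = fwd n m (e₂ b' τ) (e₁ a' τ)) →
      b = b') :
    (2 * k : ℝ) / T ≤ sumCapacity n m f nb 0 := by
  obtain ⟨ι⟩ := Function.Embedding.nonempty_of_card_le (α := Fin (2 ^ k)) (β := α)
    (by rwa [Fintype.card_fin])
  obtain ⟨o⟩ := Function.Embedding.nonempty_of_card_le (α := Fin (2 ^ k))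
    (β := Fin T × Fin f → ZMod 2) (by
      rw [Fintype.card_fin, Fintype.card_fun, Fintype.card_prod, ZMod.card, Fintype.card_fin,
        Fintype.card_fin]
      exact Nat.pow_le_pow_right (by norm_num) hf)
  rw [two_mul]
  refine le_sumCapacity_of_schemes T T k k hT hb fun K => ?_
  let msg : (Fin K → Fin (2 ^ k)) → ℕ → Fin (2 ^ k) := fun a j =>
    if h : j < K then a ⟨j, h⟩ else 0
  let slot : ℕ → Fin T := fun t => ⟨t % T, Nat.mod_lt _ hT⟩
  let out : Fin (2 ^ k) → Fin T → BSig f nb 0 := fun w τ i =>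
    if h : (i : ℕ) < f then o w (τ, ⟨i, h⟩) else 0
  have hout : ∀ w w', (∀ τ, bwd f nb f (out w τ) = bwd f nb f (out w' τ)) → w = w' := by
    intro w w' h
    refine o.injective (funext fun z => ?_)
    have := (bwd_eq_iff f nb f (le_max_right _ _) _ _).1 (h z.1) z.2 z.2.isLt
    simpa [extend, out, z.2.isLt] using this
  have slot_eq : ∀ (j : ℕ) (τ : Fin T), (j * T + τ) / T = j ∧ slot (j * T + τ) = τ := by
    intro j τ
    refine ⟨?_, Fin.ext ?_⟩
    · rw [mul_comm, Nat.mul_add_div hT, Nat.div_eq_of_lt τ.isLt, add_zero]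
    · simp [slot, Nat.mod_eq_of_lt τ.isLt]
  have early : ∀ (t : ℕ) (τ : Fin T), t / T ≠ 0 → (t / T - 1) * T + τ < t := by
    intro t τ h
    have h1 := Nat.div_mul_le_self t T
    have h2 : (t / T - 1) * T + T = t / T * T := by
      obtain ⟨j, hj⟩ := Nat.exists_eq_succ_of_ne_zero h
      rw [hj]; simp [Nat.succ_mul]
    have := τ.isLt
    omega
  have late : ∀ (j : Fin K) (τ : Fin T), (j + 1) * T + τ < T * K + T := by
    intro j τ
    have h1 : ((j : ℕ) + 1) * T ≤ K * T := Nat.mul_le_mul_right T j.isLt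
    have := τ.isLt
    rw [mul_comm T K]
    omega
  have recover : ∀ a a' : Fin K → Fin (2 ^ k), (∀ t < T * K + T,
      bwd f nb f (if t / T = 0 then 0 else out (msg a (t / T - 1)) (slot t)) =
      bwd f nb f (if t / T = 0 then 0 else out (msg a' (t / T - 1)) (slot t))) → a = a' := by
    intro a a' h
    funext j
    refine hout _ _ fun τ => ?_
    have := h _ (late j τ)
    rw [(slot_eq _ τ).1, (slot_eq _ τ).2, if_neg (by omega), if_neg (by omega)] at this
    simpa [msg] using this
  refine ⟨Fin K → Fin (2 ^ k), Fin K → Fin (2 ^ k), inferInstance, inferInstance,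
    by simp [← pow_mul, mul_comm], by simp [← pow_mul, mul_comm], ⟨?_⟩⟩
  exact
    { x₁ := fun a _ t => e₁ (ι (msg a (t / T))) (slot t)
      x₂ := fun _ b t => e₂ (ι (msg b (t / T))) (slot t)
      r₁ := fun a _ t => if t / T = 0 then 0 else out (msg a (t / T - 1)) (slot t)
      r₂ := fun _ b t => if t / T = 0 then 0 else out (msg b (t / T - 1)) (slot t)
      source₁ := fun _ _ _ _ _ => rfl
      source₂ := fun _ _ _ _ _ => rfl
      relay₁ := fun a b a' b' t h => by
        split_ifs with h0
        · rfl
        · have : msg a (t / T - 1) = msg a' (t / T - 1) := by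
            refine ι.injective (hd₁ _ (ι (msg b (t / T - 1))) _ (ι (msg b' (t / T - 1)))
              fun τ => ?_)
            have := h _ (early t τ h0)
            rwa [(slot_eq _ τ).1, (slot_eq _ τ).2] at this
          rw [this]
      relay₂ := fun a b a' b' t h => by
        split_ifs with h0
        · rfl
        · have : msg b (t / T - 1) = msg b' (t / T - 1) := by
            refine ι.injective (hd₂ (ι (msg a (t / T - 1))) _ (ι (msg a' (t / T - 1))) _
              fun τ => ?_)
            have := h _ (early t τ h0)
            rwa [(slot_eq _ τ).1, (slot_eq _ τ).2] at this
          rw [this]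
      dest₁ := fun a _ a' _ h => recover a a' h
      dest₂ := fun _ b _ b' h => recover b b' h }

theorem eq_of_fwd_eq {x y x' y' : ℕ → ZMod 2}
    (h : fwd n m (fun i => x i) (fun i => y i) = fwd n m (fun i => x' i) (fun i => y' i))
    {i : ℕ} (hi : i < max m n) :
    (if max m n - n ≤ i then x (i - (max m n - n)) else 0) +
        (if max m n - m ≤ i then y (i - (max m n - m)) else 0) =
      (if max m n - n ≤ i then x' (i - (max m n - n)) else 0) +
        (if max m n - m ≤ i then y' (i - (max m n - m)) else 0) := by
  have := congrArg (fun z => extend z i) h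
  simp only [extend_fwd _ _ _ _ hi, extend_mk] at this
  rwa [if_pos (show i - (max m n - n) < max m n by omega),
    if_pos (show i - (max m n - m) < max m n by omega),
    if_pos (show i - (max m n - n) < max m n by omega),
    if_pos (show i - (max m n - m) < max m n by omega)] at this

theorem le_sumCapacity_moderate_weak_of_block {s : ℕ} (hs : 6 ≤ s) (h : 2 * n ≤ 3 * m)
    (hmn : m < n)
    (hb : BddAbove {r : ℝ | ∃ R1 R2 : ℝ, Achievable n m f nb 0 R1 R2 ∧ r = R1 + R2}) {k : ℕ}
    (hk : k + 6 ≤ (2 * n - m) * s) (hf : k ≤ 2 * s * f) :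
    (2 * k : ℝ) / (2 * s : ℕ) ≤ sumCapacity n m f nb 0 := by
  obtain ⟨d, rfl⟩ := Nat.exists_eq_add_of_le hmn.le
  have hm : 2 ≤ m := by omega
  have hds : 6 ≤ d * (2 * s) := by
    have : 1 * (2 * 6) ≤ d * (2 * s) := Nat.mul_le_mul (by omega) (by omega)
    omega
  have hms : 6 ≤ m * s := by nlinarith
  have hle : d * (2 * s) ≤ m * s :=
    (by ring : d * (2 * s) = 2 * d * s).trans_le (Nat.mul_le_mul_right s (by omega))
  have hk' : (2 * (m + d) - m) * s = m * s + d * (2 * s) := by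
    rw [show 2 * (m + d) - m = m + 2 * d by omega]; ring
  have e8 : (8 : ℕ) = 2 ^ 3 := rfl
  obtain ⟨e₁, e₂, h₁, h₂⟩ := exists_interference_code (d := d) (m := m) (T := 2 * s)
    (c := m * s - 3) (p := d * (2 * s) - 3)
    (by
      rw [e8, ← pow_add]
      refine Nat.pow_le_pow_right (by norm_num) ?_
      have : (m + d) * (2 * s) = 2 * (m * s) + d * (2 * s) := by ring
      omega)
    (by
      rw [e8, ← pow_add]
      refine Nat.pow_le_pow_right (by norm_num) ?_
      have : m * (2 * s) = 2 * (m * s) := by ring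
      omega)
    (Or.inr (by
      rw [e8, ← pow_add]
      refine Nat.pow_le_pow_right (by norm_num) ?_
      omega))
  have hq : max m (m + d) = m + d := by omega
  have hq₁ : max m (m + d) - (m + d) = 0 := by omega
  have hq₂ : max m (m + d) - m = d := by omega
  refine le_sumCapacity_of_block_code (by omega) hb
    (α := (Fin (m * s - 3) → ZMod 2) × (Fin (d * (2 * s) - 3) → ZMod 2)) ?_ hf
    (fun a τ i => e₁ a τ i) (fun a τ i => e₂ a τ i) ?_ ?_
  · rw [Fintype.card_prod, Fintype.card_fun, Fintype.card_fun, ZMod.card,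
      Fintype.card_fin, Fintype.card_fin, ← pow_add]
    exact Nat.pow_le_pow_right (by norm_num) (by omega)
  · intro a b a' b' hab
    refine (h₁ a b a' b' fun τ i hi => ?_).1
    have := eq_of_fwd_eq (hab τ) (hq.symm ▸ hi)
    simpa [hq₁, hq₂] using this
  · intro a b a' b' hab
    refine (h₂ b a b' a' fun τ i hi => ?_).1
    have := eq_of_fwd_eq (hab τ) (hq.symm ▸ hi)
    simpa [hq₁, hq₂] using this

theorem le_sumCapacity_moderate_strong_of_block {s : ℕ} (hs : 6 ≤ s) (h : m ≤ 2 * n)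
    (hnm : n ≤ m) (hm : 1 ≤ m)
    (hb : BddAbove {r : ℝ | ∃ R1 R2 : ℝ, Achievable n m f nb 0 R1 R2 ∧ r = R1 + R2}) {k : ℕ}
    (hk : k + 6 ≤ m * s) (hf : k ≤ 2 * s * f) :
    (2 * k : ℝ) / (2 * s : ℕ) ≤ sumCapacity n m f nb 0 := by
  obtain ⟨d, rfl⟩ := Nat.exists_eq_add_of_le hnm
  have hle : (n + d) * s ≤ n * (2 * s) :=
    (Nat.mul_le_mul_right s h).trans_eq (by ring)
  have e8 : (8 : ℕ) = 2 ^ 3 := rfl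
  obtain ⟨e₁, e₂, h₁, h₂⟩ := exists_interference_code (d := d) (m := n) (T := 2 * s)
    (c := (n + d) * s - 3) (p := 0)
    (by
      rw [e8, ← pow_add]
      refine Nat.pow_le_pow_right (by norm_num) ?_
      have : (n + d) * (2 * s) = 2 * ((n + d) * s) := by ring
      omega)
    (by
      rw [e8, ← pow_add]
      refine Nat.pow_le_pow_right (by norm_num) ?_
      omega)
    (Or.inl rfl)
  have hq : max (n + d) n = n + d := by omega
  have hq₁ : max (n + d) n - n = d := by omega
  have hq₂ : max (n + d) n - (n + d) = 0 := by omega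
  refine le_sumCapacity_of_block_code (by omega) hb
    (α := (Fin ((n + d) * s - 3) → ZMod 2) × (Fin 0 → ZMod 2)) ?_ hf
    (fun a τ i => e₁ a τ i) (fun a τ i => e₂ a τ i) ?_ ?_
  · rw [Fintype.card_prod, Fintype.card_fun, Fintype.card_fun, ZMod.card,
      Fintype.card_fin, Fintype.card_fin, ← pow_add]
    exact Nat.pow_le_pow_right (by norm_num) (by omega)
  · intro a b a' b' hab
    refine Prod.ext (h₂ b a b' a' fun τ i hi => ?_).2 (Subsingleton.elim _ _)
    have := eq_of_fwd_eq (hab τ) (hq.symm ▸ hi)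
    simpa [hq₁, hq₂, add_comm] using this
  · intro a b a' b' hab
    refine Prod.ext (h₁ a b a' b' fun τ i hi => ?_).2 (Subsingleton.elim _ _)
    have := eq_of_fwd_eq (hab τ) (hq.symm ▸ hi)
    simpa [hq₁, hq₂, add_comm] using this

/-- Achievability by random linear codes without feedback. -/
theorem le_sumCapacity_moderate (h : 2 * n ≤ 3 * m) (h' : m ≤ 2 * n)
    (hb : BddAbove {r : ℝ | ∃ R1 R2 : ℝ, Achievable n m f nb 0 R1 R2 ∧ r = R1 + R2})
    {S : ℕ} (h₁ : S ≤ max (2 * n - m) m) (h₂ : S ≤ 2 * f) :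
    (S : ℝ) ≤ sumCapacity n m f nb 0 := by
  have block : ∀ s ≥ 6, ∀ k, k + 6 ≤ max (2 * n - m) m * s → k ≤ 2 * s * f →
      (2 * k : ℝ) / (2 * s : ℕ) ≤ sumCapacity n m f nb 0 := by
    intro s hs k hk hf
    rcases lt_or_ge m n with hmn | hmn
    · rw [max_eq_left (by omega)] at hk
      exact le_sumCapacity_moderate_weak_of_block hs h hmn hb hk hf
    · rw [max_eq_right (by omega)] at hk
      rcases Nat.eq_zero_or_pos m with rfl | hm
      · omega
      · exact le_sumCapacity_moderate_strong_of_block hs h' hmn hm hb hk hf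
  rcases Nat.eq_zero_or_pos S with rfl | hS
  · refine le_sumCapacity_of_schemes 1 0 0 0 one_pos hb (fun K => ?_) |>.trans' (by simp)
    refine ⟨Unit, Unit, inferInstance, inferInstance, by simp, by simp, ⟨?_⟩⟩
    exact
      { x₁ := fun _ _ _ => 0, x₂ := fun _ _ _ => 0, r₁ := fun _ _ _ => 0, r₂ := fun _ _ _ => 0
        source₁ := fun _ _ _ _ _ => rfl
        source₂ := fun _ _ _ _ _ => rfl
        relay₁ := fun _ _ _ _ _ _ => rfl
        relay₂ := fun _ _ _ _ _ _ => rfl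
        dest₁ := fun _ _ _ _ _ => rfl
        dest₂ := fun _ _ _ _ _ => rfl }
  have bound : ∀ s : ℕ, (S : ℝ) - 6 / ((s : ℝ) + 6) ≤ sumCapacity n m f nb 0 := by
    intro s
    have hSs : s + 6 ≤ S * (s + 6) := Nat.le_mul_of_pos_left _ hS
    refine (block (s + 6) (by omega) (S * (s + 6) - 6) ?_ ?_).trans' (le_of_eq ?_)
    · have := Nat.mul_le_mul_right (s + 6) h₁
      omega
    · have := Nat.mul_le_mul_right (s + 6) h₂
      have e : 2 * f * (s + 6) = 2 * (s + 6) * f := by ring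
      omega
    · rw [Nat.cast_sub (by omega)]
      push_cast
      field_simp
  have hlim : Filter.Tendsto (fun s : ℕ => (S : ℝ) - 6 / ((s : ℝ) + 6)) Filter.atTop
      (nhds ((S : ℝ) - 0)) :=
    tendsto_const_nhds.sub (Filter.Tendsto.const_div_atTop
      (Filter.tendsto_atTop_add_const_right _ _ tendsto_natCast_atTop_atTop) _)
  rw [sub_zero] at hlim
  exact le_of_tendsto' hlim bound

end TwoHopIC

namespace TwoHopIC

section Entropy

variable {Ω : Type} [Fintype Ω]

/-- The number of outcomes that `X` does not distinguish from `ω`. -/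
noncomputable def fiberCard {α : Type} (X : Ω → α) (ω : Ω) : ℝ :=
  ∑ ω', if X ω' = X ω then 1 else 0

/-- Shannon entropy in nats of a function of a uniformly distributed outcome. -/
noncomputable def ent {α : Type} (X : Ω → α) : ℝ :=
  (∑ ω, (Real.log (Fintype.card Ω) - Real.log (fiberCard X ω))) / Fintype.card Ω

/-- `X` is a function of `Z`. -/
def Determines {α β : Type} (Z : Ω → α) (X : Ω → β) : Prop :=
  ∀ ω ω', Z ω = Z ω' → X ω = X ω'

variable {α β γ : Type}

theorem fiberCard_pos (X : Ω → α) (ω : Ω) : 0 < fiberCard X ω := by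
  have h := Finset.single_le_sum (f := fun ω' => if X ω' = X ω then (1 : ℝ) else 0)
    (fun i _ => by split_ifs <;> norm_num) (Finset.mem_univ ω)
  simp only [if_true] at h
  exact lt_of_lt_of_le one_pos h

theorem fiberCard_congr (X : Ω → α) {ω ω' : Ω} (h : X ω = X ω') :
    fiberCard X ω = fiberCard X ω' := by
  simp only [fiberCard, h]

theorem sum_inv_fiberCard_le (X : Ω → α) (x : α) :
    ∑ ω, (if X ω = x then (fiberCard X ω)⁻¹ else 0) ≤ 1 := by
  by_cases h : ∃ ω₀, X ω₀ = x
  · obtain ⟨ω₀, rfl⟩ := h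
    have : ∀ ω, (if X ω = X ω₀ then (fiberCard X ω)⁻¹ else 0) =
        (if X ω = X ω₀ then 1 else 0) * (fiberCard X ω₀)⁻¹ := by
      intro ω
      split_ifs with h
      · rw [one_mul, fiberCard_congr X h]
      · simp
    simp_rw [this]
    rw [← Finset.sum_mul]
    exact (mul_inv_cancel₀ (fiberCard_pos X ω₀).ne').le
  · rw [Finset.sum_eq_zero]
    · norm_num
    · intro ω _
      exact if_neg fun hω => h ⟨ω, hω⟩

theorem ent_mono {X : Ω → α} {Y : Ω → β} (h : Determines X Y) : ent Y ≤ ent X := by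
  unfold ent
  gcongr with ω
  · exact fiberCard_pos X ω
  · unfold fiberCard
    refine Finset.sum_le_sum fun ω' _ => ?_
    split_ifs with h1 h2
    · exact le_rfl
    · exact absurd (h _ _ h1) h2
    · exact zero_le_one
    · exact le_rfl

variable [Nonempty Ω]

theorem card_pos_real : (0 : ℝ) < Fintype.card Ω := by
  exact_mod_cast Fintype.card_pos

/-- Gibbs' inequality. -/
theorem ent_le_of_sum_le_one [Fintype α] (X : Ω → α) (p : α → ℝ) (hp : ∀ x, 0 < p x)
    (hsum : ∑ x, p x ≤ 1) : ent X ≤ (∑ ω, -Real.log (p (X ω))) / Fintype.card Ω := by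
  have hc := card_pos_real (Ω := Ω)
  unfold ent
  gcongr ?_ / _
  rw [← sub_nonpos, ← Finset.sum_sub_distrib]
  have h1 : ∀ ω, Real.log (Fintype.card Ω) - Real.log (fiberCard X ω) - -Real.log (p (X ω)) ≤
      Fintype.card Ω * (p (X ω) * (fiberCard X ω)⁻¹) - 1 := by
    intro ω
    have hf := fiberCard_pos X ω
    rw [sub_neg_eq_add, ← Real.log_div hc.ne' hf.ne', ← Real.log_mul (by positivity) (hp _).ne']
    refine (Real.log_le_sub_one_of_pos (mul_pos (by positivity) (hp _))).trans_eq ?_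
    rw [div_eq_mul_inv]; ring
  have h2 : ∑ ω, p (X ω) * (fiberCard X ω)⁻¹ ≤ 1 := by
    calc ∑ ω, p (X ω) * (fiberCard X ω)⁻¹
        = ∑ ω, ∑ x, p x * (if X ω = x then (fiberCard X ω)⁻¹ else 0) := by
          refine Finset.sum_congr rfl fun ω _ => ?_
          simp
      _ = ∑ x, p x * ∑ ω, (if X ω = x then (fiberCard X ω)⁻¹ else 0) := by
          rw [Finset.sum_comm]
          simp_rw [Finset.mul_sum]
      _ ≤ ∑ x, p x * 1 := by
          gcongr with x
          · exact (hp x).le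
          · exact sum_inv_fiberCard_le X x
      _ ≤ 1 := by simpa using hsum
  calc _ ≤ ∑ ω : Ω, ((Fintype.card Ω : ℝ) * (p (X ω) * (fiberCard X ω)⁻¹) - 1) :=
        Finset.sum_le_sum fun ω _ => h1 ω
    _ = Fintype.card Ω * ∑ ω, p (X ω) * (fiberCard X ω)⁻¹ - Fintype.card Ω := by
        rw [Finset.sum_sub_distrib, ← Finset.mul_sum]; simp
    _ ≤ 0 := by nlinarith

theorem ent_le_log_card [Fintype α] (X : Ω → α) : ent X ≤ Real.log (Fintype.card α) := by
  have hc := card_pos_real (Ω := Ω)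
  have : Nonempty α := ‹Nonempty Ω›.map X
  have ha : (0 : ℝ) < Fintype.card α := card_pos_real
  refine (ent_le_of_sum_le_one X (fun _ => (Fintype.card α : ℝ)⁻¹) (fun _ => by positivity)
    ?_).trans_eq ?_
  · simp [ha.ne']
  · simp [hc.ne']

/-- Submodularity of entropy. -/
theorem ent_submodular (X : Ω → α) (Y : Ω → β) (Z : Ω → γ) :
    ent (fun ω => (X ω, Y ω, Z ω)) + ent Z ≤
      ent (fun ω => (X ω, Z ω)) + ent fun ω => (Y ω, Z ω) := by
  have hc := card_pos_real (Ω := Ω)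
  unfold ent
  rw [← add_div, ← add_div]
  gcongr ?_ / _
  rw [← sub_nonpos, ← Finset.sum_add_distrib, ← Finset.sum_add_distrib,
    ← Finset.sum_sub_distrib]
  set W := fun ω => (X ω, Y ω, Z ω) with hW
  set U := fun ω => (X ω, Z ω) with hU
  set V := fun ω => (Y ω, Z ω) with hV
  have h1 : ∀ ω, Real.log (Fintype.card Ω) - Real.log (fiberCard W ω) +
      (Real.log (Fintype.card Ω) - Real.log (fiberCard Z ω)) -
      (Real.log (Fintype.card Ω) - Real.log (fiberCard U ω) +
      (Real.log (Fintype.card Ω) - Real.log (fiberCard V ω))) ≤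
      fiberCard U ω * fiberCard V ω * ((fiberCard W ω)⁻¹ * (fiberCard Z ω)⁻¹) - 1 := by
    intro ω
    have p1 := fiberCard_pos U ω
    have p2 := fiberCard_pos V ω
    have p3 := fiberCard_pos W ω
    have p4 := fiberCard_pos Z ω
    refine le_trans (le_of_eq ?_) (Real.log_le_sub_one_of_pos (by positivity))
    rw [Real.log_mul (by positivity) (by positivity), Real.log_mul p1.ne' p2.ne',
      Real.log_mul (by positivity) (by positivity), Real.log_inv, Real.log_inv]
    ring
  have h2 : ∑ ω, fiberCard U ω * fiberCard V ω * ((fiberCard W ω)⁻¹ * (fiberCard Z ω)⁻¹) ≤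
      Fintype.card Ω := by
    calc ∑ ω, fiberCard U ω * fiberCard V ω * ((fiberCard W ω)⁻¹ * (fiberCard Z ω)⁻¹)
        = ∑ ω, ∑ ω₁, ∑ ω₂, (if Z ω₂ = Z ω₁ then (fiberCard Z ω₁)⁻¹ else 0) *
            (if W ω = (X ω₁, Y ω₂, Z ω₁) then (fiberCard W ω)⁻¹ else 0) := by
          refine Finset.sum_congr rfl fun ω _ => ?_
          rw [fiberCard, fiberCard, Finset.sum_mul_sum, Finset.sum_mul]
          refine Finset.sum_congr rfl fun ω₁ _ => ?_
          rw [Finset.sum_mul]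
          refine Finset.sum_congr rfl fun ω₂ _ => ?_
          simp only [hU, hV, hW, Prod.mk.injEq]
          by_cases c1 : X ω₁ = X ω ∧ Z ω₁ = Z ω
          · by_cases c2 : Y ω₂ = Y ω ∧ Z ω₂ = Z ω
            · rw [if_pos c1, if_pos c2, if_pos (c2.2.trans c1.2.symm),
                if_pos ⟨c1.1.symm, c2.1.symm, c1.2.symm⟩, fiberCard_congr Z c1.2]
              ring
            · rw [if_neg c2]
              by_cases c3 : Z ω₂ = Z ω₁
              · rw [if_neg (c := X ω = X ω₁ ∧ Y ω = Y ω₂ ∧ Z ω = Z ω₁)]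
                · ring
                · exact fun c4 => c2 ⟨c4.2.1.symm, c3.trans c1.2⟩
              · rw [if_neg c3]; ring
          · rw [if_neg c1, if_neg (c := X ω = X ω₁ ∧ Y ω = Y ω₂ ∧ Z ω = Z ω₁)]
            · ring
            · exact fun c4 => c1 ⟨c4.1.symm, c4.2.2.symm⟩
      _ = ∑ ω₁, ∑ ω₂, (if Z ω₂ = Z ω₁ then (fiberCard Z ω₁)⁻¹ else 0) *
            ∑ ω, (if W ω = (X ω₁, Y ω₂, Z ω₁) then (fiberCard W ω)⁻¹ else 0) := by
          rw [Finset.sum_comm]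
          refine Finset.sum_congr rfl fun ω₁ _ => ?_
          rw [Finset.sum_comm]
          simp_rw [Finset.mul_sum]
      _ ≤ ∑ ω₁, ∑ ω₂, (if Z ω₂ = Z ω₁ then (fiberCard Z ω₁)⁻¹ else 0) * 1 := by
          gcongr with ω₁ _ ω₂ _
          · split_ifs
            · exact (inv_pos.2 (fiberCard_pos Z ω₁)).le
            · exact le_rfl
          · refine le_of_eq_of_le (Finset.sum_congr rfl fun ω _ => ?_)
              (sum_inv_fiberCard_le W (X ω₁, Y ω₂, Z ω₁))
            congr
      _ = ∑ ω₁ : Ω, 1 := by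
          refine Finset.sum_congr rfl fun ω₁ _ => ?_
          refine Eq.trans ?_ (mul_inv_cancel₀ (fiberCard_pos Z ω₁).ne')
          conv_rhs => rw [fiberCard, Finset.sum_mul]
          refine Finset.sum_congr rfl fun ω₂ _ => ?_
          rw [mul_one, ite_mul, one_mul, zero_mul]
          rfl
      _ = Fintype.card Ω := by simp
  refine (Finset.sum_le_sum fun ω _ => h1 ω).trans ?_
  rw [Finset.sum_sub_distrib]
  simpa using h2

theorem ent_pair_le (X : Ω → α) (Y : Ω → β) :
    ent (fun ω => (X ω, Y ω)) ≤ ent X + ent Y := by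
  have h := ent_submodular X Y fun _ => ()
  have h0 : ent (fun _ : Ω => ()) = 0 := by simp [ent, fiberCard]
  have hX : ent (fun ω => (X ω, ())) ≤ ent X := ent_mono fun ω ω' h => by simp [h]
  have hY : ent (fun ω => (Y ω, ())) ≤ ent Y := ent_mono fun ω ω' h => by simp [h]
  have hXY : ent (fun ω => (X ω, Y ω)) ≤ ent fun ω => (X ω, Y ω, ()) :=
    ent_mono fun ω ω' h => by simpa using h
  linarith

/-- Adjoining a variable with a finite alphabet. -/
theorem ent_le_add_log_card [Fintype β] {X : Ω → α} {Z : Ω → γ} (B : Ω → β)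
    (h : Determines (fun ω => (Z ω, B ω)) X) : ent X ≤ ent Z + Real.log (Fintype.card β) :=
  (ent_mono h).trans ((ent_pair_le Z B).trans (by gcongr; exact ent_le_log_card B))

/-- Adjoining `k` bits per channel use. -/
theorem ent_le_add_bits {N k : ℕ} {X : Ω → α} {Z : Ω → γ} (B : Ω → Fin N → Fin k → ZMod 2)
    (h : Determines (fun ω => (Z ω, B ω)) X) : ent X ≤ ent Z + N * k * Real.log 2 := by
  refine (ent_le_add_log_card B h).trans_eq ?_
  rw [Fintype.card_fun, Fintype.card_fun, ZMod.card, Fintype.card_fin, Fintype.card_fin,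
    ← pow_mul, Nat.cast_pow, Real.log_pow]
  push_cast
  ring

theorem ent_le_bits {N k : ℕ} {X : Ω → α} (B : Ω → Fin N → Fin k → ZMod 2)
    (h : Determines B X) : ent X ≤ N * k * Real.log 2 := by
  have h0 : ent (fun _ : Ω => ()) = 0 := by simp [ent, fiberCard]
  have := ent_le_add_bits (Z := fun _ : Ω => ()) B (X := X) fun ω ω' hω => h _ _ (by simpa using hω)
  linarith

/-- Fano's inequality, for an error event of probability at most `ε`. -/
theorem fano {M : ℕ} {ε : ℝ} (hε : 0 < ε) (hε1 : ε < 1) (W : Ω → Fin M) (Z : Ω → γ)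
    (g : γ → Fin M)
    (herr : ((Finset.univ.filter fun ω => g (Z ω) ≠ W ω).card : ℝ) ≤ ε * Fintype.card Ω) :
    ent (fun ω => (Z ω, W ω)) ≤
      ent Z + (-Real.log (1 - ε) + ε * (Real.log M - Real.log ε)) := by
  have hc := card_pos_real (Ω := Ω)
  have hM : 0 < M := (W (Classical.arbitrary Ω)).pos
  have hM' : (1 : ℝ) ≤ M := by exact_mod_cast hM
  let E : Ω → Option (Fin M) := fun ω => if g (Z ω) = W ω then none else some (W ω)
  have h1 : ent (fun ω => (Z ω, W ω)) ≤ ent fun ω => (Z ω, E ω) := by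
    refine ent_mono fun ω ω' h => ?_
    simp only [Prod.mk.injEq, E] at h ⊢
    refine ⟨h.1, ?_⟩
    have h2 := h.2
    rw [h.1] at h2
    split_ifs at h2 with c1 c2 c2
    · exact c1.symm.trans c2
    · exact Option.some.inj h2
  have h2 := ent_pair_le Z E
  let p : Option (Fin M) → ℝ := fun o => o.elim (1 - ε) fun _ => ε / M
  have h3 := ent_le_of_sum_le_one E p
    (fun o => by cases o <;> simp only [p, Option.elim] <;> [linarith; positivity])
    (by
      rw [Fintype.sum_option]
      simp only [p, Option.elim, Finset.sum_const, Finset.card_univ, Fintype.card_fin,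
        nsmul_eq_mul]
      rw [mul_div_cancel₀ _ (by positivity)]
      linarith)
  have h4 : (∑ ω, -Real.log (p (E ω))) / Fintype.card Ω ≤
      -Real.log (1 - ε) + ε * (Real.log M - Real.log ε) := by
    have hl1 : 0 ≤ -Real.log (1 - ε) := by
      have := Real.log_nonpos (by linarith : 0 ≤ 1 - ε) (by linarith)
      linarith
    have hl2 : 0 ≤ Real.log M - Real.log ε := by
      have := Real.log_nonneg hM'
      have := Real.log_nonpos hε.le hε1.le
      linarith
    have h5 : ∀ ω, -Real.log (p (E ω)) ≤ -Real.log (1 - ε) +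
        (if g (Z ω) ≠ W ω then 1 else 0) * (Real.log M - Real.log ε) := by
      intro ω
      by_cases h : g (Z ω) = W ω
      · simp [p, E, h]
      · simp only [p, E, if_neg h, ne_eq, h, not_false_eq_true, if_true, Option.elim, one_mul]
        rw [Real.log_div hε.ne' (by positivity)]
        linarith
    rw [div_le_iff₀ hc]
    refine (Finset.sum_le_sum fun ω _ => h5 ω).trans ?_
    rw [Finset.sum_add_distrib, ← Finset.sum_mul, Finset.sum_boole]
    simp only [Finset.sum_const, Finset.card_univ, nsmul_eq_mul]
    nlinarith
  linarith

end Entropy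

end TwoHopIC

namespace TwoHopIC

/-- The signals of a code as functions of the outcome, together with the constraints on the
information available at each terminal and Fano's inequality at the two destinations. -/
structure Run (n m f nb N : ℕ) (Ω : Type) [Fintype Ω] (A B : Type) (η₁ η₂ : ℝ) where
  a : Ω → A
  b : Ω → B
  x : Ω → ℕ → FSig n m
  y : Ω → ℕ → FSig n m
  r : Ω → ℕ → BSig f nb 0
  s : Ω → ℕ → BSig f nb 0
  source₁ : ∀ ω ω' t, a ω = a ω' → (∀ u < t, bwd f nb nb (r ω u) = bwd f nb nb (r ω' u)) →
    x ω t = x ω' t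
  source₂ : ∀ ω ω' t, b ω = b ω' → (∀ u < t, bwd f nb nb (s ω u) = bwd f nb nb (s ω' u)) →
    y ω t = y ω' t
  relay₁ : ∀ ω ω' t, (∀ u < t, fwd n m (x ω u) (y ω u) = fwd n m (x ω' u) (y ω' u)) →
    r ω t = r ω' t
  relay₂ : ∀ ω ω' t, (∀ u < t, fwd n m (y ω u) (x ω u) = fwd n m (y ω' u) (x ω' u)) →
    s ω t = s ω' t
  inj : ∀ ω ω', a ω = a ω' → b ω = b ω' → ω = ω'
  indep : ent a + ent b ≤ ent fun ω => (a ω, b ω)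
  fano₁ : ∀ {γ : Type} (Z : Ω → γ),
    Determines Z (fun ω (t : Fin N) => bwd f nb f (r ω t)) →
      ent (fun ω => (Z ω, a ω)) ≤ ent Z + η₁
  fano₂ : ∀ {γ : Type} (Z : Ω → γ),
    Determines Z (fun ω (t : Fin N) => bwd f nb f (s ω t)) →
      ent (fun ω => (Z ω, b ω)) ≤ ent Z + η₂

namespace Run

variable {n m f nb N : ℕ} {Ω : Type} [Fintype Ω] {A B : Type} {η₁ η₂ : ℝ}

/-- Exchange of the two users. -/
def swap (R : Run n m f nb N Ω A B η₁ η₂) : Run n m f nb N Ω B A η₂ η₁ where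
  a := R.b
  b := R.a
  x := R.y
  y := R.x
  r := R.s
  s := R.r
  source₁ := R.source₂
  source₂ := R.source₁
  relay₁ := R.relay₂
  relay₂ := R.relay₁
  inj ω ω' h h' := R.inj ω ω' h' h
  indep := by
    rw [add_comm]
    exact R.indep.trans (ent_mono fun ω ω' h => by
      simp only [Prod.mk.injEq] at h ⊢; exact ⟨h.2, h.1⟩)
  fano₁ := R.fano₂
  fano₂ := R.fano₁

/-- The signals received by relay 1. -/
def relayRx (R : Run n m f nb N Ω A B η₁ η₂) (ω : Ω) (t : Fin N) : FSig n m :=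
  fwd n m (R.x ω t) (R.y ω t)

/-- The signals overheard by source 1. -/
def sourceRx (R : Run n m f nb N Ω A B η₁ η₂) (ω : Ω) (t : Fin N) : BSig f nb 0 :=
  bwd f nb nb (R.r ω t)

/-- The part of the signals of source 1 heard by relay 2. -/
def common (R : Run n m f nb N Ω A B η₁ η₂) (ω : Ω) (t : Fin N) (i : Fin m) : ZMod 2 :=
  extend (R.x ω t) i

variable (R : Run n m f nb N Ω A B η₁ η₂) {ω ω' : Ω}

theorem r_eq (h : R.relayRx ω = R.relayRx ω') {t : ℕ} (ht : t < N) : R.r ω t = R.r ω' t :=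
  R.relay₁ _ _ _ fun u hu => congrFun h ⟨u, hu.trans ht⟩

theorem x_eq (ha : R.a ω = R.a ω') (h : R.sourceRx ω = R.sourceRx ω') {t : ℕ} (ht : t < N) :
    R.x ω t = R.x ω' t :=
  R.source₁ _ _ _ ha fun u hu => congrFun h ⟨u, hu.trans ht⟩

theorem sourceRx_eq (h : R.relayRx ω = R.relayRx ω') : R.sourceRx ω = R.sourceRx ω' :=
  funext fun t => congrArg (bwd f nb nb) (R.r_eq h t.isLt)

theorem determines_dest {γ : Type} {Z : Ω → γ} (h : Determines Z R.relayRx) :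
    Determines Z (fun ω (t : Fin N) => bwd f nb f (R.r ω t)) :=
  fun ω ω' hω => funext fun t => congrArg (bwd f nb f) (R.r_eq (h ω ω' hω) t.isLt)

theorem extend_eq_of_fwd_eq {x y y' : FSig n m} (h : fwd n m x y = fwd n m x y')
    {i : ℕ} (hi : i < m) : extend y i = extend y' i := by
  have h1 : i + (max m n - m) < max m n := by omega
  have := congrArg (fun z => extend z (i + (max m n - m))) h
  simpa [extend_fwd n m _ _ h1] using this

theorem common_swap_eq (ha : R.a ω = R.a ω') (h : R.relayRx ω = R.relayRx ω') :
    R.swap.common ω = R.swap.common ω' := by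
  funext t i
  have h1 : fwd n m (R.x ω t) (R.y ω t) = fwd n m (R.x ω' t) (R.y ω' t) := congrFun h t
  rw [R.x_eq ha (R.sourceRx_eq h) t.isLt] at h1
  exact extend_eq_of_fwd_eq h1 i.isLt

variable [Nonempty Ω]

theorem ent_message_le : ent R.a ≤ N * f * Real.log 2 + η₁ := by
  have h1 : ent R.a ≤ ent (fun ω => ((fun t : Fin N => bwd f nb f (R.r ω t)), R.a ω)) :=
    ent_mono fun ω ω' h => (Prod.mk.inj h).2
  have h2 := R.fano₁ (fun ω (t : Fin N) => bwd f nb f (R.r ω t)) fun _ _ h => h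
  have h3 : ent (fun ω (t : Fin N) => bwd f nb f (R.r ω t)) ≤ N * f * Real.log 2 :=
    ent_le_bits (fun ω t (i : Fin f) => extend (R.r ω t) i) fun ω ω' h => funext fun t =>
      (bwd_eq_iff f nb f (le_max_right _ _) _ _).2 fun i hi => congrFun (congrFun h t) ⟨i, hi⟩
  linarith

theorem ent_source_le : ent (fun ω => (R.a ω, R.sourceRx ω)) ≤ ent R.a + N * nb * Real.log 2 := by
  refine ent_le_add_bits (fun ω t (i : Fin nb) => extend (R.r ω t) i) fun ω ω' h => ?_
  simp only [Prod.mk.injEq] at h ⊢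
  exact ⟨h.1, funext fun t => (bwd_eq_iff f nb nb (le_max_left _ _) _ _).2
    fun i hi => congrFun (congrFun h.2 t) ⟨i, hi⟩⟩

theorem ent_source_le_relay :
    ent (fun ω => (R.a ω, R.sourceRx ω)) ≤ N * (max nb f : ℕ) * Real.log 2 + η₁ := by
  have h1 : ent (fun ω => (R.a ω, R.sourceRx ω)) ≤
      ent (fun ω => ((fun t : Fin N => R.r ω t), R.a ω)) := by
    refine ent_mono fun ω ω' h => ?_
    simp only [Prod.mk.injEq] at h ⊢
    exact ⟨h.2, funext fun t => congrArg (bwd f nb nb) (congrFun h.1 t)⟩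
  have h2 := R.fano₁ (fun ω (t : Fin N) => R.r ω t) fun ω ω' h =>
    funext fun t => congrArg (bwd f nb f) (congrFun h t)
  have h3 : ent (fun ω (t : Fin N) => R.r ω t) ≤ N * (max nb f : ℕ) * Real.log 2 :=
    ent_le_bits (fun ω t (i : Fin (max nb f)) => extend (R.r ω t) i) fun ω ω' h =>
      funext fun t => extend_injective fun i hi =>
        congrFun (congrFun h t) ⟨i, by omega⟩
  linarith

theorem ent_pair_le_relays :
    ent R.a + ent R.b ≤ N * (max m n + (n - m) : ℕ) * Real.log 2 + (η₁ + η₂) := by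
  have h1 : ent (fun ω => (R.a ω, R.b ω)) ≤
      ent (fun ω => (((R.relayRx ω, R.a ω), R.swap.relayRx ω), R.b ω)) := by
    refine ent_mono fun ω ω' h => ?_
    simp only [Prod.mk.injEq] at h ⊢
    exact ⟨h.1.1.2, h.2⟩
  have h2 := R.fano₂ (fun ω => ((R.relayRx ω, R.a ω), R.swap.relayRx ω))
    (R.swap.determines_dest fun ω ω' h => (Prod.mk.inj h).2)
  have h3 : ent (fun ω => ((R.relayRx ω, R.a ω), R.swap.relayRx ω)) ≤
      ent (fun ω => (R.relayRx ω, R.a ω)) + N * (n - m : ℕ) * Real.log 2 := by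
    refine ent_le_add_bits (fun ω t (i : Fin (n - m)) => extend (R.y ω t) (m + i))
      fun ω ω' h => ?_
    simp only [Prod.mk.injEq] at h ⊢
    refine ⟨h.1, funext fun t => extend_injective fun i hi => ?_⟩
    have hc := R.common_swap_eq h.1.2 h.1.1
    have hx := R.x_eq h.1.2 (R.sourceRx_eq h.1.1) t.isLt
    change extend (fwd n m (R.y ω t) (R.x ω t)) i = extend (fwd n m (R.y ω' t) (R.x ω' t)) i
    rw [extend_fwd n m _ _ hi, extend_fwd n m _ _ hi, hx]
    congr 1
    split_ifs with hin
    · set j := i - (max m n - n) with hj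
      by_cases hjm : j < m
      · exact congrFun (congrFun hc t) ⟨j, hjm⟩
      · have := congrFun (congrFun h.2 t) ⟨j - m, by omega⟩
        simpa only [Nat.add_sub_cancel' (not_lt.1 hjm)] using this
    · rfl
  have h4 := R.fano₁ R.relayRx (R.determines_dest fun _ _ h => h)
  have h5 : ent R.relayRx ≤ N * (max m n : ℕ) * Real.log 2 :=
    ent_le_bits R.relayRx fun _ _ h => h
  have := R.indep
  push_cast at h3 h5 ⊢
  linarith

theorem ent_common_le (hmn : m ≤ n) :
    ent (fun ω => (R.a ω, R.swap.common ω)) + ent R.a + ent R.b ≤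
      ent (fun ω => (R.b ω, R.common ω)) + ent (fun ω => (R.a ω, R.sourceRx ω)) +
        N * (max (n - m) m : ℕ) * Real.log 2 + η₁ := by
  have h1 : ent (fun ω => (R.a ω, R.swap.common ω)) ≤
      ent (fun ω => ((R.relayRx ω, R.common ω), R.a ω)) := by
    refine ent_mono fun ω ω' h => ?_
    simp only [Prod.mk.injEq] at h ⊢
    exact ⟨h.2, R.common_swap_eq h.2 h.1.1⟩
  have h2 := R.fano₁ (fun ω => (R.relayRx ω, R.common ω))
    (R.determines_dest fun ω ω' h => (Prod.mk.inj h).1)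
  have h3 : ent (fun ω => (R.relayRx ω, R.common ω)) ≤
      ent R.common + N * (max (n - m) m : ℕ) * Real.log 2 := by
    refine ent_le_add_bits (fun ω t (i : Fin (max (n - m) m)) =>
      extend (R.relayRx ω t) (n - max (n - m) m + i)) fun ω ω' h => ?_
    simp only [Prod.mk.injEq] at h ⊢
    refine ⟨funext fun t => extend_injective fun i hi => ?_, h.1⟩
    by_cases hin : i < n - max (n - m) m
    · change extend (fwd n m (R.x ω t) (R.y ω t)) i = extend (fwd n m (R.x ω' t) (R.y ω' t)) i
      rw [extend_fwd n m _ _ hi, extend_fwd n m _ _ hi, if_neg (c := max m n - m ≤ i) (by omega),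
        if_neg (c := max m n - m ≤ i) (by omega), if_pos (by omega), if_pos (by omega)]
      congr 1
      exact congrFun (congrFun h.1 t) ⟨i - (max m n - n), by omega⟩
    · have := congrFun (congrFun h.2 t) ⟨i - (n - max (n - m) m), by omega⟩
      simpa only [Nat.add_sub_cancel' (not_lt.1 hin)] using this
  have h4 := ent_submodular R.b (fun ω => (R.a ω, R.sourceRx ω)) R.common
  have h5 : ent (fun ω => ((R.a ω, R.sourceRx ω), R.common ω)) ≤
      ent (fun ω => (R.a ω, R.sourceRx ω)) := by
    refine ent_mono fun ω ω' h => ?_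
    simp only [Prod.mk.injEq] at h ⊢
    refine ⟨h, funext fun t => funext fun i => ?_⟩
    simp only [common, R.x_eq h.1 h.2 t.isLt]
  have h6 : ent (fun ω => (R.a ω, R.b ω)) ≤
      ent (fun ω => (R.b ω, (R.a ω, R.sourceRx ω), R.common ω)) := by
    refine ent_mono fun ω ω' h => ?_
    simp only [Prod.mk.injEq] at h ⊢
    exact ⟨h.2.1.1, h.1⟩
  have := R.indep
  linarith

theorem ent_pair_le_genie :
    ent R.a + ent R.b ≤
      ent (fun ω => (R.b ω, R.swap.sourceRx ω)) + N * n * Real.log 2 + η₁ := by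
  have h1 : ent (fun ω => (R.a ω, R.b ω)) ≤
      ent (fun ω => (((R.b ω, R.swap.sourceRx ω), R.relayRx ω), R.a ω)) := by
    refine ent_mono fun ω ω' h => ?_
    simp only [Prod.mk.injEq] at h ⊢
    exact ⟨h.2, h.1.1.1⟩
  have h2 := R.fano₁ (fun ω => ((R.b ω, R.swap.sourceRx ω), R.relayRx ω))
    (R.determines_dest fun ω ω' h => (Prod.mk.inj h).2)
  have h3 : ent (fun ω => ((R.b ω, R.swap.sourceRx ω), R.relayRx ω)) ≤
      ent (fun ω => (R.b ω, R.swap.sourceRx ω)) + N * n * Real.log 2 := by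
    refine ent_le_add_bits (fun ω t (i : Fin n) => extend (R.x ω t) i) fun ω ω' h => ?_
    simp only [Prod.mk.injEq] at h ⊢
    refine ⟨h.1, funext fun t => extend_injective fun i hi => ?_⟩
    have hy : R.y ω t = R.y ω' t := R.swap.x_eq h.1.1 h.1.2 t.isLt
    change extend (fwd n m (R.x ω t) (R.y ω t)) i = extend (fwd n m (R.x ω' t) (R.y ω' t)) i
    rw [extend_fwd n m _ _ hi, extend_fwd n m _ _ hi, hy]
    congr 1
    split_ifs with hin
    · exact congrFun (congrFun h.2 t) ⟨i - (max m n - n), by omega⟩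
    · rfl
  have := R.indep
  linarith

/-- The part of the first hop that is not limited by feedback, in the regimes of weak and of
strong interference. -/
theorem two_mul_ent_le {k : ℕ} (hk : (m ≤ n ∧ k = max (n - m) m) ∨ k = n) :
    2 * (ent R.a + ent R.b) ≤ ent (fun ω => (R.a ω, R.sourceRx ω)) +
      ent (fun ω => (R.b ω, R.swap.sourceRx ω)) + 2 * (N * k * Real.log 2) + (η₁ + η₂) := by
  rcases hk with ⟨h, rfl⟩ | rfl
  · have h1 := R.ent_common_le h
    have h2 := R.swap.ent_common_le h
    change ent (fun ω => (R.b ω, R.common ω)) + ent R.b + ent R.a ≤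
      ent (fun ω => (R.a ω, R.swap.common ω)) + _ + _ + _ at h2
    change _ ≤ _ + ent (fun ω => (R.swap.a ω, R.swap.sourceRx ω)) + _ + _
    linarith
  · have h1 := R.ent_pair_le_genie
    have h2 := R.swap.ent_pair_le_genie
    change ent R.b + ent R.a ≤ ent (fun ω => (R.a ω, R.sourceRx ω)) + _ + _ at h2
    linarith

theorem ent_add_le_of_feedback {k : ℕ}
    (hk : (m ≤ n ∧ k = max (n - m) m) ∨ k = n) :
    ent R.a + ent R.b ≤ N * (2 * k + 2 * nb : ℕ) * Real.log 2 + (η₁ + η₂) := by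
  have h := R.two_mul_ent_le hk
  have h1 := R.ent_source_le
  have h2 : ent (fun ω => (R.b ω, R.swap.sourceRx ω)) ≤ _ := R.swap.ent_source_le
  change _ ≤ ent R.b + _ at h2
  push_cast
  linarith

theorem ent_add_le_of_relay {k : ℕ}
    (hk : (m ≤ n ∧ k = max (n - m) m) ∨ k = n) :
    ent R.a + ent R.b ≤ N * (max nb f + k : ℕ) * Real.log 2 + (η₁ + η₂) := by
  have h := R.two_mul_ent_le hk
  have h1 := R.ent_source_le_relay
  have h2 : ent (fun ω => (R.b ω, R.swap.sourceRx ω)) ≤ _ := R.swap.ent_source_le_relay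
  push_cast at h1 h2 ⊢
  linarith

theorem ent_add_le_of_dest :
    ent R.a + ent R.b ≤ N * (2 * f : ℕ) * Real.log 2 + (η₁ + η₂) := by
  have h1 := R.ent_message_le
  have h2 : ent R.b ≤ _ := R.swap.ent_message_le
  push_cast
  linarith

end Run

end TwoHopIC

namespace TwoHopIC

section FromCode

variable {n m f nb N M1 M2 : ℕ} (C : Code n m f nb 0 N M1 M2)

theorem srcHist_eq_srcXat (w1 : Fin M1) (w2 : Fin M2) (t : ℕ) (s : Fin t) :
    srcHist C w1 w2 t s = srcXat C w1 w2 s := by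
  induction t with
  | zero => exact s.elim0
  | succ t ih =>
    refine Fin.lastCases rfl (fun i => ?_) s
    rw [srcHist, Fin.snoc_castSucc, ih]
    rfl

theorem relayTx1_srcHist (w1 : Fin M1) (w2 : Fin M2) (t : ℕ) (s : Fin t) :
    relayTx1 C (srcHist C w1 w2 t) s = relayTxAt1 C w1 w2 s := by
  simp only [relayTxAt1, relayTx1, relayRx1_eq, srcHist_eq_srcXat, Fin.val_last]

theorem relayTx2_srcHist (w1 : Fin M1) (w2 : Fin M2) (t : ℕ) (s : Fin t) :
    relayTx2 C (srcHist C w1 w2 t) s = relayTxAt2 C w1 w2 s := by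
  simp only [relayTxAt2, relayTx2, relayRx2_eq, srcHist_eq_srcXat, Fin.val_last]

theorem relayTxAt1_eq (w1 : Fin M1) (w2 : Fin M2) (t : ℕ) :
    relayTxAt1 C w1 w2 t = C.encR1 t fun u => fwd n m (srcXat C w1 w2 u).1 (srcXat C w1 w2 u).2 := by
  simp only [relayTxAt1, relayTx1, relayRx1_eq, srcHist_eq_srcXat, Fin.val_last]

theorem relayTxAt2_eq (w1 : Fin M1) (w2 : Fin M2) (t : ℕ) :
    relayTxAt2 C w1 w2 t = C.encR2 t fun u => fwd n m (srcXat C w1 w2 u).2 (srcXat C w1 w2 u).1 := by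
  simp only [relayTxAt2, relayTx2, relayRx2_eq, srcHist_eq_srcXat, Fin.val_last]

theorem srcXat_eq (w1 : Fin M1) (w2 : Fin M2) (t : ℕ) :
    srcXat C w1 w2 t =
      (C.encS1 t w1 fun s => bwd f nb nb (relayTxAt1 C w1 w2 s),
        C.encS2 t w2 fun s => bwd f nb nb (relayTxAt2 C w1 w2 s)) := by
  have h1 : srcRx1 C (srcHist C w1 w2 t) = fun s : Fin t => bwd f nb nb (relayTxAt1 C w1 w2 s) :=
    funext fun s => by rw [srcRx1_eq, relayTx1_srcHist]
  have h2 : srcRx2 C (srcHist C w1 w2 t) = fun s : Fin t => bwd f nb nb (relayTxAt2 C w1 w2 s) :=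
    funext fun s => by rw [srcRx2_eq, relayTx2_srcHist]
  rw [srcXat, srcHist, Fin.snoc_last, h1, h2]

theorem ent_fst [NeZero M1] [NeZero M2] :
    ent (fun ω : Fin M1 × Fin M2 => ω.1) = Real.log M1 := by
  have h1 : (M1 : ℝ) ≠ 0 := NeZero.ne _
  have h2 : (M2 : ℝ) ≠ 0 := NeZero.ne _
  have : ∀ ω : Fin M1 × Fin M2, fiberCard (fun ω : Fin M1 × Fin M2 => ω.1) ω = M2 := by
    intro ω
    rw [fiberCard, Fintype.sum_prod_type, Finset.sum_eq_single ω.1]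
    · simp
    · intro i _ hi
      simp [hi]
    · simp
  simp only [ent, this, Fintype.card_prod, Fintype.card_fin, Finset.sum_const, Finset.card_univ,
    nsmul_eq_mul, Nat.cast_mul]
  rw [mul_div_cancel_left₀ _ (mul_ne_zero h1 h2), Real.log_mul h1 h2]
  ring

theorem ent_snd [NeZero M1] [NeZero M2] :
    ent (fun ω : Fin M1 × Fin M2 => ω.2) = Real.log M2 := by
  have h1 : (M1 : ℝ) ≠ 0 := NeZero.ne _
  have h2 : (M2 : ℝ) ≠ 0 := NeZero.ne _
  have : ∀ ω : Fin M1 × Fin M2, fiberCard (fun ω : Fin M1 × Fin M2 => ω.2) ω = M1 := by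
    intro ω
    rw [fiberCard, Fintype.sum_prod_type_right, Finset.sum_eq_single ω.2]
    · simp
    · intro i _ hi
      simp [hi]
    · simp
  simp only [ent, this, Fintype.card_prod, Fintype.card_fin, Finset.sum_const, Finset.card_univ,
    nsmul_eq_mul, Nat.cast_mul]
  rw [mul_div_cancel_left₀ _ (mul_ne_zero h1 h2), Real.log_mul h1 h2]
  ring

theorem ent_messages [NeZero M1] [NeZero M2] :
    ent (fun ω : Fin M1 × Fin M2 => (ω.1, ω.2)) = Real.log M1 + Real.log M2 := by
  have h1 : (M1 : ℝ) ≠ 0 := NeZero.ne _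
  have h2 : (M2 : ℝ) ≠ 0 := NeZero.ne _
  have : ∀ ω : Fin M1 × Fin M2, fiberCard (fun ω : Fin M1 × Fin M2 => (ω.1, ω.2)) ω = 1 := by
    intro ω
    simp [fiberCard]
  simp only [ent, this, Fintype.card_prod, Fintype.card_fin, Finset.sum_const, Finset.card_univ,
    nsmul_eq_mul, Nat.cast_mul, Real.log_one, sub_zero]
  rw [mul_div_cancel_left₀ _ (mul_ne_zero h1 h2), Real.log_mul h1 h2]

/-- The penalty in Fano's inequality for a message of size `M`. -/
noncomputable def fanoTerm (ε : ℝ) (M : ℕ) : ℝ :=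
  -Real.log (1 - ε) + ε * (Real.log M - Real.log ε)

theorem fano_of_determines {Ω γ δ : Type} [Fintype Ω] [Nonempty Ω] {M : ℕ} {ε : ℝ} (hε : 0 < ε)
    (hε1 : ε < 1) (W : Ω → Fin M) (D : Ω → δ) (g : δ → Fin M)
    (herr : ((Finset.univ.filter fun ω => g (D ω) ≠ W ω).card : ℝ) ≤ ε * Fintype.card Ω)
    (Z : Ω → γ) (hZ : Determines Z D) :
    ent (fun ω => (Z ω, W ω)) ≤ ent Z + fanoTerm ε M := by
  have : Inhabited δ := ⟨D (Classical.arbitrary Ω)⟩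
  obtain ⟨k, hk⟩ := ZeroErrorScheme.choose_factor Z D hZ
  refine fano hε hε1 W Z (fun z => g (k z)) ?_
  simpa only [hk] using herr

theorem card_err_le [NeZero M1] [NeZero M2] {ε : ℝ} (hC : errProb C ≤ ε)
    {p : Fin M1 × Fin M2 → Prop} [DecidablePred p]
    (hp : ∀ ω, p ω → C.dec1 (fun t => destRx1 C ω.1 ω.2 t) ≠ ω.1 ∨
      C.dec2 (fun t => destRx2 C ω.1 ω.2 t) ≠ ω.2) :
    ((Finset.univ.filter p).card : ℝ) ≤ ε * Fintype.card (Fin M1 × Fin M2) := by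
  have h0 : (0 : ℝ) < M1 * M2 := by
    have := NeZero.pos M1
    have := NeZero.pos M2
    positivity
  rw [errProb, div_le_iff₀ h0] at hC
  rw [Fintype.card_prod, Fintype.card_fin, Fintype.card_fin, Nat.cast_mul]
  refine le_trans (Nat.cast_le.2 (Finset.card_le_card fun ω hω => ?_)) hC
  rw [Finset.mem_filter] at hω ⊢
  exact ⟨hω.1, hp ω hω.2⟩

/-- The signals of a code of small error probability. -/
noncomputable def Run.ofCode [NeZero M1] [NeZero M2] {ε : ℝ} (hε : 0 < ε) (hε1 : ε < 1)
    (hC : errProb C ≤ ε) :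
    Run n m f nb N (Fin M1 × Fin M2) (Fin M1) (Fin M2) (fanoTerm ε M1) (fanoTerm ε M2) where
  a ω := ω.1
  b ω := ω.2
  x ω t := (srcXat C ω.1 ω.2 t).1
  y ω t := (srcXat C ω.1 ω.2 t).2
  r ω t := relayTxAt1 C ω.1 ω.2 t
  s ω t := relayTxAt2 C ω.1 ω.2 t
  source₁ := by
    rintro ⟨a, b⟩ ⟨_, b'⟩ t rfl h
    rw [srcXat_eq, srcXat_eq C a b']
    exact congrArg (C.encS1 t a) (funext fun s => h s s.isLt)
  source₂ := by
    rintro ⟨a, b⟩ ⟨a', _⟩ t rfl h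
    rw [srcXat_eq, srcXat_eq C a' b]
    exact congrArg (C.encS2 t b) (funext fun s => h s s.isLt)
  relay₁ ω ω' t h := by
    rw [relayTxAt1_eq, relayTxAt1_eq]
    exact congrArg (C.encR1 t) (funext fun s => h s s.isLt)
  relay₂ ω ω' t h := by
    rw [relayTxAt2_eq, relayTxAt2_eq]
    exact congrArg (C.encR2 t) (funext fun s => h s s.isLt)
  inj _ _ := Prod.ext
  indep := by rw [ent_fst, ent_snd, ent_messages]
  fano₁ Z hZ := fano_of_determines hε hε1 (fun ω : Fin M1 × Fin M2 => ω.1)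
    (fun ω (t : Fin N) => destRx1 C ω.1 ω.2 t) C.dec1 (card_err_le C hC fun _ => Or.inl) Z hZ
  fano₂ Z hZ := fano_of_determines hε hε1 (fun ω : Fin M1 × Fin M2 => ω.2)
    (fun ω (t : Fin N) => destRx2 C ω.1 ω.2 t) C.dec2 (card_err_le C hC fun _ => Or.inr) Z hZ

end FromCode

variable {n m f nb : ℕ}

theorem log_ceil_rpow_ge (x : ℝ) : x * Real.log 2 ≤ Real.log ⌈(2 : ℝ) ^ x⌉₊ := by
  rw [← Real.log_rpow (by norm_num)]
  exact Real.log_le_log (by positivity) (Nat.le_ceil _)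

theorem log_ceil_rpow_le {x : ℝ} (hx : 0 ≤ x) :
    Real.log ⌈(2 : ℝ) ^ x⌉₊ ≤ (x + 1) * Real.log 2 := by
  rw [← Real.log_rpow (by norm_num)]
  refine Real.log_le_log (Nat.cast_pos.2 (Nat.ceil_pos.2 (by positivity))) ?_
  have h1 : (1 : ℝ) ≤ 2 ^ x := Real.one_le_rpow (by norm_num) hx
  have h2 := Nat.ceil_lt_add_one (show (0 : ℝ) ≤ 2 ^ x by positivity)
  rw [Real.rpow_add (by norm_num), Real.rpow_one]
  linarith

/-- An entropy bound for all codes limits the achievable rates. -/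
theorem Achievable.add_le {R₁ R₂ : ℝ} {c : ℕ} (h : Achievable n m f nb 0 R₁ R₂)
    (hc : ∀ {N M₁ M₂ : ℕ} {η₁ η₂ : ℝ} [Nonempty (Fin M₁ × Fin M₂)]
      (R : Run n m f nb N (Fin M₁ × Fin M₂) (Fin M₁) (Fin M₂) η₁ η₂),
      ent R.a + ent R.b ≤ N * c * Real.log 2 + (η₁ + η₂)) : R₁ + R₂ ≤ c := by
  obtain ⟨hR₁, hR₂, h⟩ := h
  have hl : 0 < Real.log 2 := Real.log_pos (by norm_num)
  have bound : ∀ ε : ℝ, 0 < ε → ε < 1 → (R₁ + R₂) * Real.log 2 ≤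
      c * Real.log 2 + 2 * (-Real.log (1 - ε) + Real.negMulLog ε) +
        ε * (R₁ + R₂ + 2) * Real.log 2 := by
    intro ε hε hε1
    obtain ⟨N, hN, C, hC⟩ := h ε hε
    have ne : ∀ x : ℝ, NeZero ⌈(2 : ℝ) ^ x⌉₊ := fun x =>
      ⟨(Nat.ceil_pos.2 (Real.rpow_pos_of_pos (by norm_num) _)).ne'⟩
    have := ne (N * R₁)
    have := ne (N * R₂)
    have key := hc (Run.ofCode C hε hε1 hC)
    have ea : ent (Run.ofCode C hε hε1 hC).a = Real.log ⌈(2 : ℝ) ^ ((N : ℝ) * R₁)⌉₊ := ent_fst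
    have eb : ent (Run.ofCode C hε hε1 hC).b = Real.log ⌈(2 : ℝ) ^ ((N : ℝ) * R₂)⌉₊ := ent_snd
    rw [ea, eb, fanoTerm, fanoTerm] at key
    have hN1 : (1 : ℝ) ≤ N := by exact_mod_cast hN
    have l₁ := log_ceil_rpow_ge (N * R₁)
    have l₂ := log_ceil_rpow_ge (N * R₂)
    have u₁ := mul_le_mul_of_nonneg_left (log_ceil_rpow_le (x := N * R₁) (by positivity)) hε.le
    have u₂ := mul_le_mul_of_nonneg_left (log_ceil_rpow_le (x := N * R₂) (by positivity)) hε.le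
    have hp : 0 ≤ -Real.log (1 - ε) + Real.negMulLog ε := by
      have h1 := Real.log_nonpos (by linarith : 0 ≤ 1 - ε) (by linarith)
      have h2 := Real.negMulLog_nonneg hε.le hε1.le
      linarith
    have hp1 := mul_le_mul_of_nonneg_right hN1 hp
    have hp2 := mul_le_mul_of_nonneg_right hN1 (by positivity : 0 ≤ ε * Real.log 2)
    have hNpos : (0 : ℝ) < N := by linarith
    refine le_of_mul_le_mul_left ?_ hNpos
    have e : Real.negMulLog ε = -(ε * Real.log ε) := by rw [Real.negMulLog]; ring
    rw [e] at hp1 ⊢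
    nlinarith
  have hlim : Filter.Tendsto (fun ε : ℝ => c * Real.log 2 +
      2 * (-Real.log (1 - ε) + Real.negMulLog ε) + ε * (R₁ + R₂ + 2) * Real.log 2)
      (nhdsWithin 0 (Set.Ioi 0)) (nhds (c * Real.log 2)) := by
    have hcont : ContinuousAt (fun ε : ℝ => c * Real.log 2 +
      2 * (-Real.log (1 - ε) + Real.negMulLog ε) + ε * (R₁ + R₂ + 2) * Real.log 2) 0 := by
      have h1 : ContinuousAt (fun ε : ℝ => Real.log (1 - ε)) 0 :=
        ContinuousAt.log (by fun_prop) (by norm_num)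
      have h2 : ContinuousAt Real.negMulLog 0 := Real.continuous_negMulLog.continuousAt
      fun_prop
    have := hcont.tendsto.mono_left (nhdsWithin_le_nhds (s := Set.Ioi 0))
    simpa using this
  have := ge_of_tendsto hlim (by
    filter_upwards [Ioo_mem_nhdsGT (show (0 : ℝ) < 1 by norm_num)] with ε hε
    exact bound ε hε.1 hε.2)
  exact le_of_mul_le_mul_right this hl

theorem Achievable.add_le_dest {R₁ R₂ : ℝ} (h : Achievable n m f nb 0 R₁ R₂) :
    R₁ + R₂ ≤ (2 * f : ℕ) := h.add_le fun R => R.ent_add_le_of_dest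

theorem bddAbove_sumRates :
    BddAbove {r : ℝ | ∃ R1 R2 : ℝ, Achievable n m f nb 0 R1 R2 ∧ r = R1 + R2} :=
  ⟨(2 * f : ℕ), by rintro _ ⟨_, _, h, rfl⟩; exact h.add_le_dest⟩

theorem sumCapacity_le {c : ℕ} (h : ∀ {R₁ R₂ : ℝ}, Achievable n m f nb 0 R₁ R₂ → R₁ + R₂ ≤ c) :
    sumCapacity n m f nb 0 ≤ c :=
  Real.sSup_le (by rintro _ ⟨_, _, hR, rfl⟩; exact h hR) (Nat.cast_nonneg c)

end TwoHopIC

open TwoHopIC in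
/-- Capacity with no backward cross-link (Theorem 3). -/
theorem sumCapacity_no_crosslink (n m f nb : ℕ) :
    (3 * m ≤ 2 * n →
      sumCapacity n m f nb 0 =
        min ((f : ℝ) + max ((n : ℝ) - m) m + max ((nb : ℝ) - f) 0)
          (min (2 * max ((n : ℝ) - m) m + 2 * nb)
            (min (2 * (n : ℝ) - m) (2 * f)))) ∧
    (2 * n ≤ 3 * m → m ≤ 2 * n →
      sumCapacity n m f nb 0 = min (max (2 * (n : ℝ) - m) (m : ℝ)) (2 * f)) ∧
    (2 * n ≤ m →
      sumCapacity n m f nb 0 =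
        min ((n : ℝ) + f + max ((nb : ℝ) - f) 0)
          (min (2 * (n : ℝ) + 2 * nb) (min (m : ℝ) (2 * f)))) := by
  have hF : (f : ℝ) + max ((nb : ℝ) - f) 0 = (max f nb : ℕ) := by
    rw [Nat.cast_max, max_comm (f : ℝ), ← max_add_add_left]
    simp
  have upper : ∀ {c : ℕ}, (∀ {R₁ R₂ : ℝ}, Achievable n m f nb 0 R₁ R₂ → R₁ + R₂ ≤ c) →
      sumCapacity n m f nb 0 ≤ c := sumCapacity_le
  have hd := upper Achievable.add_le_dest
  have hr := upper fun h => h.add_le fun R => R.ent_pair_le_relays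
  refine ⟨fun h => ?_, fun h h' => ?_, fun h => ?_⟩
  · have hmn : m ≤ n := by omega
    have hk : (m ≤ n ∧ max (n - m) m = max (n - m) m) ∨ max (n - m) m = n := Or.inl ⟨hmn, rfl⟩
    have e1 : (f : ℝ) + max ((n : ℝ) - m) m + max ((nb : ℝ) - f) 0 =
        (max f nb + max (n - m) m : ℕ) := by
      rw [add_right_comm, hF, Nat.cast_add, Nat.cast_max (m := n - m), Nat.cast_sub hmn]
    have e2 : 2 * max ((n : ℝ) - m) m + 2 * nb = (2 * max (n - m) m + 2 * nb : ℕ) := by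
      push_cast [Nat.cast_sub hmn]; rfl
    have e3 : 2 * (n : ℝ) - m = (2 * n - m : ℕ) := by
      rw [Nat.cast_sub (by omega)]; push_cast; rfl
    have e4 : 2 * (f : ℝ) = (2 * f : ℕ) := by push_cast; rfl
    rw [e1, e2, e3, e4, ← Nat.cast_min, ← Nat.cast_min, ← Nat.cast_min]
    refine le_antisymm ?_ (le_sumCapacity_weak h bddAbove_sumRates (by omega) (by omega)
      (by omega) (by omega))
    rw [Nat.cast_min, Nat.cast_min, Nat.cast_min]
    have hf := upper fun h => h.add_le fun R => R.ent_add_le_of_feedback hk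
    have hl := upper fun h => h.add_le fun R => R.ent_add_le_of_relay hk
    rw [max_comm nb f] at hl
    rw [show max m n + (n - m) = 2 * n - m by omega] at hr
    exact le_min hl (le_min hf (le_min hr hd))
  · have e1 : max (2 * (n : ℝ) - m) (m : ℝ) = (max (2 * n - m) m : ℕ) := by
      push_cast [Nat.cast_sub h']; rfl
    have e4 : 2 * (f : ℝ) = (2 * f : ℕ) := by push_cast; rfl
    rw [e1, e4, ← Nat.cast_min]
    refine le_antisymm ?_ (le_sumCapacity_moderate h h' bddAbove_sumRates (by omega) (by omega))
    rw [Nat.cast_min]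
    rw [show max m n + (n - m) = max (2 * n - m) m by omega] at hr
    exact le_min hr hd
  · have hk : (m ≤ n ∧ n = max (n - m) m) ∨ n = n := Or.inr rfl
    have e1 : (n : ℝ) + f + max ((nb : ℝ) - f) 0 = (max f nb + n : ℕ) := by
      rw [add_assoc, hF, add_comm, Nat.cast_add]
    have e2 : 2 * (n : ℝ) + 2 * nb = (2 * n + 2 * nb : ℕ) := by push_cast; rfl
    have e4 : 2 * (f : ℝ) = (2 * f : ℕ) := by push_cast; rfl
    rw [e1, e2, e4, ← Nat.cast_min, ← Nat.cast_min, ← Nat.cast_min]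
    refine le_antisymm ?_ (le_sumCapacity_strong h bddAbove_sumRates (by omega) (by omega)
      (by omega) (by omega))
    rw [Nat.cast_min, Nat.cast_min, Nat.cast_min]
    have hf := upper fun h => h.add_le fun R => R.ent_add_le_of_feedback hk
    have hl := upper fun h => h.add_le fun R => R.ent_add_le_of_relay hk
    rw [max_comm nb f] at hl
    rw [show max m n + (n - m) = m by omega] at hr
    exact le_min hl (le_min hf (le_min hr hd))
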